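/- arXiv:2507.11828 — 2 statements merged into one kernel-verified Lean document; each statement's English description precedes it below -/
import Mathlib

section
/- Let q be an odd prime and k ≥ 1 a natural number. Let S = {s_1, …, s_ℓ} be a finite set of nonzero integers not containing any perfect q-th power, and let n be the number of distinct primes dividing ∏_{j=1}^{ℓ} rad_q(|s_j|). Then S belongs to 𝒯_{k,q} if and only if the set of projective points associated with S is a k-blocking set of PG(F_q^n). -/
open Finset

/-- `S ∈ 𝒯_{k,q}`: there is a positive integer `Δ` such that for every natural number `N`
with `Ω(N) ≤ k` and `gcd(N, Δ) = 1`, some `s ∈ S` is a `q`-th power modulo `N`. -/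
def MemT (q k : ℕ) (S : Set ℤ) : Prop :=
  ∃ Δ : ℕ, 0 < Δ ∧ ∀ N : ℕ, 0 < N → N.primeFactorsList.length ≤ k → Nat.Coprime N Δ →
    ∃ s ∈ S, ∃ x : ℤ, (N : ℤ) ∣ x ^ q - s

/-- `s` is a perfect `q`-th power of an integer. -/
def IsPerfectPow (q : ℕ) (s : ℤ) : Prop := ∃ r : ℤ, r ^ q = s

/-- The finite set of primes dividing `∏_{s ∈ S} rad_q(|s|)`, i.e. the primes `p` such that
`q ∤ v_p(|s|)` for some `s ∈ S`. -/
def qPrimes (q : ℕ) (S : Finset ℤ) : Finset ℕ :=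
  S.sup fun s => s.natAbs.primeFactors.filter fun p => ¬ q ∣ s.natAbs.factorization p

/-- The vector `(v_{p_1}(|u|) mod q, …, v_{p_n}(|u|) mod q)` where `p_1 < … < p_n`
is the increasing enumeration of the finite set of primes `P`. -/
def vecOf (q : ℕ) (P : Finset ℕ) (u : ℤ) : Fin P.card → ZMod q :=
  fun i => ((u.natAbs.factorization (P.orderIsoOfFin rfl i).1 : ℕ) : ZMod q)

/-- The projective point `⟨v⟩` of `PG(F_q^n)` spanned by a vector `v`. -/
def projPoint {q n : ℕ} (v : Fin n → ZMod q) : Submodule (ZMod q) (Fin n → ZMod q) :=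
  Submodule.span (ZMod q) {v}

/-- The set of projective points associated with `S` in `PG(F_q^n)`,
`n` being the number of distinct primes dividing `∏_{s ∈ S} rad_q(|s|)`. -/
def assocPoints (q : ℕ) (S : Finset ℤ) :
    Set (Submodule (ZMod q) (Fin (qPrimes q S).card → ZMod q)) :=
  {P | ∃ s ∈ S, P = projPoint (vecOf q (qPrimes q S) s)}

/-- `B` is a `k`-blocking set of `PG(F_q^n)`: every subspace of codimension `k`
contains a nonzero vector spanning a point of `B`. -/
def IsBlockingSet (q n k : ℕ) (B : Set (Submodule (ZMod q) (Fin n → ZMod q))) : Prop :=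
  ∀ W : Submodule (ZMod q) (Fin n → ZMod q), Module.finrank (ZMod q) W = n - k →
    ∃ v ∈ W, v ≠ 0 ∧ projPoint v ∈ B

/-- `B` is (the point set of) a `k`-space of `PG(F_q^n)`. -/
def IsKSpace (q n k : ℕ) (B : Set (Submodule (ZMod q) (Fin n → ZMod q))) : Prop :=
  ∃ W : Submodule (ZMod q) (Fin n → ZMod q), Module.finrank (ZMod q) W = k + 1 ∧
    B = {P | ∃ v ∈ W, v ≠ 0 ∧ P = projPoint v}

/-- `S` and `T` are geometrically `q`-equivalent: some element of `PGL(n, q)` maps the point set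
associated with `S` onto the point set associated with `T`, where the points are computed with
respect to all the primes dividing `(∏_{s ∈ S} rad_q(|s|)) ⬝ (∏_{t ∈ T} rad_q(|t|))`. -/
def GeomEquiv (q : ℕ) (S T : Finset ℤ) : Prop :=
  ∃ Ψ : (Fin (qPrimes q (S ∪ T)).card → ZMod q) ≃ₗ[ZMod q]
        (Fin (qPrimes q (S ∪ T)).card → ZMod q),
    (Submodule.map Ψ.toLinearMap) ''
        {P | ∃ s ∈ S, P = projPoint (vecOf q (qPrimes q (S ∪ T)) s)} =
      {P | ∃ t ∈ T, P = projPoint (vecOf q (qPrimes q (S ∪ T)) t)}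

/-- The set of squares of `F_qˣ` together with `0`. -/
def Q0 (q : ℕ) : Set (ZMod q) := {x | (∃ a : ZMod q, a ≠ 0 ∧ a ^ 2 = x) ∨ x = 0}

namespace QBlock

section PartA
open Finset Filter Topology NumberField IsDedekindDomain

noncomputable section ZetaPart
variable (K : Type*) [Field K] [NumberField K]

/-- `N(I)^{-s}`. -/
def idN (s : ℝ) (I : Ideal (𝓞 K)) : ℝ := (Ideal.absNorm I : ℝ) ^ (-s)

lemma idN_nonneg (s : ℝ) (I : Ideal (𝓞 K)) : 0 ≤ idN K s I := by
  unfold idN; positivity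

lemma idN_mul (s : ℝ) (I J : Ideal (𝓞 K)) : idN K s (I * J) = idN K s I * idN K s J := by
  unfold idN
  rw [map_mul, Nat.cast_mul, Real.mul_rpow (by positivity) (by positivity)]

lemma idN_one (s : ℝ) : idN K s 1 = 1 := by
  unfold idN; simp

lemma idN_prod (s : ℝ) {ι : Type*} (A : Finset ι) (f : ι → Ideal (𝓞 K)) :
    idN K s (∏ i ∈ A, f i) = ∏ i ∈ A, idN K s (f i) := by
  classical
  induction A using Finset.induction with
  | empty => rw [prod_empty, prod_empty, idN_one]
  | insert a A ha ih => rw [prod_insert ha, prod_insert ha, idN_mul, ih]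

lemma idN_zero {s : ℝ} (hs : s ≠ 0) : idN K s ⊥ = 0 := by
  unfold idN; simp [hs, Real.zero_rpow]

lemma idN_anti {s t : ℝ} (hs : 0 < s) (hst : s ≤ t) (I : Ideal (𝓞 K)) : idN K t I ≤ idN K s I := by
  by_cases h : I = ⊥
  · subst h; rw [idN_zero K hs.ne', idN_zero K (hs.trans_le hst).ne']
  · unfold idN
    apply Real.rpow_le_rpow_of_exponent_le
    · have : Ideal.absNorm I ≠ 0 := by rwa [Ne, Ideal.absNorm_eq_zero_iff]
      exact_mod_cast Nat.one_le_iff_ne_zero.mpr this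
    · linarith

lemma idN_le_one {s : ℝ} (hs : 0 < s) (I : Ideal (𝓞 K)) : idN K s I ≤ 1 := by
  by_cases h : I = ⊥
  · subst h; rw [idN_zero K hs.ne']; exact zero_le_one
  · unfold idN
    apply Real.rpow_le_one_of_one_le_of_nonpos
    · have : Ideal.absNorm I ≠ 0 := by rwa [Ne, Ideal.absNorm_eq_zero_iff]
      exact_mod_cast Nat.one_le_iff_ne_zero.mpr this
    · linarith

lemma idN_sq (s : ℝ) (I : Ideal (𝓞 K)) : idN K s I ^ 2 = idN K (2 * s) I := by
  unfold idN
  rw [← Real.rpow_natCast, ← Real.rpow_mul (by positivity)]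
  congr 1; push_cast; ring

/-- coefficient count -/
def idC (n : ℕ) : ℕ := Nat.card {I : Ideal (𝓞 K) // Ideal.absNorm I = n}

lemma idN_fiber_hasSum (s : ℝ) (n : ℕ) :
    HasSum (fun I : {I : Ideal (𝓞 K) // Ideal.absNorm I = n} => idN K s I)
      ((idC K n : ℝ) * (n : ℝ) ^ (-s)) := by
  have hfin : Finite {I : Ideal (𝓞 K) // Ideal.absNorm I = n} :=
    Ideal.finite_setOfPred_absNorm_eq n
  have := Fintype.ofFinite {I : Ideal (𝓞 K) // Ideal.absNorm I = n}
  have h := hasSum_fintype (fun I : {I : Ideal (𝓞 K) // Ideal.absNorm I = n} => idN K s I)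
  convert h using 1
  rw [Finset.sum_congr rfl (g := fun _ => (n : ℝ) ^ (-s))]
  · simp [idC, Nat.card_eq_fintype_card]
  · rintro ⟨I, hI⟩ _
    simp [idN, hI]

lemma term_eq {s : ℝ} (hs : 1 < s) (n : ℕ) :
    LSeries.term (fun n => ((Nat.card {I : Ideal (𝓞 K) // Ideal.absNorm I = n} : ℕ) : ℂ)) s n =
      (((idC K n : ℝ) * (n : ℝ) ^ (-s) : ℝ) : ℂ) := by
  rcases eq_or_ne n 0 with rfl | hn
  · rw [LSeries.term_zero]
    simp [Real.zero_rpow (show -s ≠ 0 by linarith)]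
  · rw [LSeries.term_of_ne_zero hn, idC]
    push_cast
    rw [Complex.ofReal_cpow (by positivity)]
    push_cast
    rw [Complex.cpow_neg, div_eq_mul_inv]

lemma idN_summable_of_coeff {s : ℝ}
    (h : Summable (fun n : ℕ => (idC K n : ℝ) * (n : ℝ) ^ (-s))) :
    Summable (idN K s) ∧ ∑' I, idN K s I = ∑' n : ℕ, (idC K n : ℝ) * (n : ℝ) ^ (-s) := by
  let e := Equiv.sigmaFiberEquiv (fun I : Ideal (𝓞 K) => Ideal.absNorm I)
  have h1 : Summable (fun x : (Σ n : ℕ, {I : Ideal (𝓞 K) // Ideal.absNorm I = n}) =>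
      idN K s (e x)) := by
    rw [summable_sigma_of_nonneg (fun _ => idN_nonneg K s _)]
    refine ⟨fun n => (idN_fiber_hasSum K s n).summable, ?_⟩
    convert h using 2 with n
    exact (idN_fiber_hasSum K s n).tsum_eq
  refine ⟨(e.summable_iff).mp h1, ?_⟩
  rw [← e.tsum_eq, h1.tsum_sigma]
  exact tsum_congr fun n => (idN_fiber_hasSum K s n).tsum_eq

theorem zeta_tendsto :
    (∀ s : ℝ, 1 < s → Summable (idN K s)) ∧
    Tendsto (fun s : ℝ => (s - 1) * ∑' I, idN K s I) (𝓝[>] 1)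
      (𝓝 (dedekindZeta_residue K)) := by
  have hT := tendsto_sub_one_mul_dedekindZeta_nhdsGT K
  have hsum : ∀ s : ℝ, 1 < s → Summable (fun n : ℕ => (idC K n : ℝ) * (n : ℝ) ^ (-s)) := by
    intro s hs
    have hne : ∀ᶠ t : ℝ in 𝓝[>] 1, ((t - 1 : ℝ) : ℂ) * dedekindZeta K t ≠ 0 := by
      have := hT.eventually_ne (show ((dedekindZeta_residue K : ℝ) : ℂ) ≠ 0 by
        exact_mod_cast dedekindZeta_residue_ne_zero K)
      filter_upwards [this] with t ht
      simpa using ht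
    have hlt : ∀ᶠ t : ℝ in 𝓝[>] 1, 1 < t ∧ t < s := by
      filter_upwards [Ioo_mem_nhdsGT hs] with t ht using ht
    obtain ⟨t, h1, ht1, hts⟩ := (hne.and hlt).exists
    have h2 : dedekindZeta K t ≠ 0 := right_ne_zero_of_mul h1
    have h3 : Summable (LSeries.term
        (fun n => ((Nat.card {I : Ideal (𝓞 K) // Ideal.absNorm I = n} : ℕ) : ℂ)) t) := by
      by_contra hcon
      exact h2 (tsum_eq_zero_of_not_summable hcon)
    rw [funext (term_eq K ht1)] at h3
    rw [Complex.summable_ofReal] at h3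
    refine Summable.of_nonneg_of_le (fun n => by positivity) (fun n => ?_) h3
    rcases eq_or_ne n 0 with rfl | hn
    · simp [Real.zero_rpow (show -s ≠ 0 by linarith), Real.zero_rpow (show -t ≠ 0 by linarith)]
    · gcongr
      exact_mod_cast Nat.one_le_iff_ne_zero.mpr hn
  refine ⟨fun s hs => (idN_summable_of_coeff K (hsum s hs)).1, ?_⟩
  rw [← tendsto_ofReal_iff]
  refine hT.congr' ?_
  filter_upwards [self_mem_nhdsWithin] with s hs
  have hs : 1 < s := hs
  rw [(idN_summable_of_coeff K (hsum s hs)).2, dedekindZeta, LSeries, tsum_congr (term_eq K hs)]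
  push_cast
  rfl

end ZetaPart

end PartA

section PartB
open Finset Filter Topology NumberField IsDedekindDomain

noncomputable section ZetaPart2
variable (K : Type*) [Field K] [NumberField K]

/-- sum over primes -/
def prS (s : ℝ) : ℝ := ∑' P : HeightOneSpectrum (𝓞 K), idN K s P.asIdeal

lemma asIdeal_inj : Function.Injective (fun P : HeightOneSpectrum (𝓞 K) => P.asIdeal) :=
  fun _ _ h => HeightOneSpectrum.ext h

lemma prS_summable {s : ℝ} (hs : 1 < s) :
    Summable (fun P : HeightOneSpectrum (𝓞 K) => idN K s P.asIdeal) :=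
  ((zeta_tendsto K).1 s hs).comp_injective (asIdeal_inj K)

lemma exists_sqfree_mul_sq (I : Ideal (𝓞 K)) (hI : I ≠ ⊥) :
    ∃ (A : Finset (HeightOneSpectrum (𝓞 K))) (J : Ideal (𝓞 K)),
      I = (∏ P ∈ A, P.asIdeal) * (J * J) := by
  classical
  induction I using UniqueFactorizationMonoid.induction_on_prime with
  | h₁ => exact absurd rfl hI
  | h₂ x hx => exact ⟨∅, 1, by rw [prod_empty, one_mul, one_mul, Ideal.one_eq_top]; exact Ideal.isUnit_iff.mp hx⟩
  | h₃ a p ha hp ih =>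
    obtain ⟨A, J, h⟩ := ih ha
    let P : HeightOneSpectrum (𝓞 K) := ⟨p, Ideal.isPrime_of_prime hp, hp.ne_zero⟩
    have hP : p = P.asIdeal := rfl
    by_cases hPA : P ∈ A
    · refine ⟨A.erase P, p * J, ?_⟩
      rw [h, ← mul_prod_erase A _ hPA, hP]
      ring
    · refine ⟨insert P A, J, ?_⟩
      rw [prod_insert hPA, h, hP]; ring

lemma dvd_of_prod (A : Finset (HeightOneSpectrum (𝓞 K))) (P : HeightOneSpectrum (𝓞 K))
    (h : P.asIdeal ∣ ∏ Q ∈ A, Q.asIdeal) : P ∈ A := by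
  obtain ⟨Q, hQ, hd⟩ := (Prime.dvd_finsetProd_iff P.prime _).mp h
  have : P.asIdeal = Q.asIdeal := by
    have := (P.prime.irreducible.associated_of_dvd Q.prime.irreducible hd)
    exact associated_iff_eq.mp this
  rwa [asIdeal_inj K this]

lemma prod_inj : Function.Injective
    (fun A : Finset (HeightOneSpectrum (𝓞 K)) => ∏ P ∈ A, P.asIdeal) := by
  intro A B h
  have h : ∏ P ∈ A, P.asIdeal = ∏ P ∈ B, P.asIdeal := h
  ext P
  constructor
  · intro hP
    exact dvd_of_prod K B P (h ▸ dvd_prod_of_mem _ hP)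
  · intro hP
    exact dvd_of_prod K A P (h ▸ dvd_prod_of_mem _ hP)

theorem zeta_le {s : ℝ} (hs : 1 < s) :
    ∑' I, idN K s I ≤ Real.exp (prS K s) * ∑' I, idN K 2 I := by
  classical
  have hsum := (zeta_tendsto K).1
  refine Real.tsum_le_of_sum_le (fun I => idN_nonneg K s I) fun F => ?_
  choose! A J hAJ using exists_sqfree_mul_sq K
  let F' := F.filter (· ≠ ⊥)
  let B := F'.image A
  let U := B.biUnion id
  let JJ := F'.image J
  have h0 : ∑ I ∈ F, idN K s I = ∑ I ∈ F', idN K s I := by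
    rw [sum_filter_of_ne]
    intro I _ h hI
    exact h (hI ▸ idN_zero K (by linarith))
  rw [h0]
  calc ∑ I ∈ F', idN K s I
      = ∑ I ∈ F', (∏ P ∈ A I, idN K s P.asIdeal) * idN K (2 * s) (J I) := by
        refine sum_congr rfl fun I hI => ?_
        conv_lhs => rw [hAJ I (mem_filter.mp hI).2]
        rw [idN_mul, idN_prod, idN_mul, ← sq, idN_sq]
    _ = ∑ x ∈ F'.image (fun I => (A I, J I)),
          (∏ P ∈ x.1, idN K s P.asIdeal) * idN K (2 * s) x.2 := by
        rw [sum_image]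
        intro I hI I' hI' h
        simp only [Prod.mk.injEq] at h
        rw [hAJ I (mem_filter.mp hI).2, hAJ I' (mem_filter.mp hI').2, h.1, h.2]
    _ ≤ ∑ x ∈ U.powerset ×ˢ JJ, (∏ P ∈ x.1, idN K s P.asIdeal) * idN K (2 * s) x.2 := by
        refine sum_le_sum_of_subset_of_nonneg ?_ ?_
        · intro x hx
          obtain ⟨I, hI, rfl⟩ := mem_image.mp hx
          refine mem_product.mpr ⟨?_, mem_image_of_mem _ hI⟩
          rw [mem_powerset]
          exact subset_biUnion_of_mem id (mem_image_of_mem A hI)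
        · intro x _ _
          exact mul_nonneg (prod_nonneg fun _ _ => idN_nonneg K _ _) (idN_nonneg K _ _)
    _ = (∏ P ∈ U, (1 + idN K s P.asIdeal)) * ∑ I ∈ JJ, idN K (2 * s) I := by
        rw [prod_one_add, sum_mul_sum, sum_product]
    _ ≤ Real.exp (prS K s) * ∑' I, idN K 2 I := by
        refine mul_le_mul ?_ ?_ (sum_nonneg fun _ _ => idN_nonneg K _ _) (Real.exp_pos _).le
        · calc ∏ P ∈ U, (1 + idN K s P.asIdeal) ≤ ∏ P ∈ U, Real.exp (idN K s P.asIdeal) := by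
                refine prod_le_prod (fun P _ => by linarith [idN_nonneg K s P.asIdeal]) ?_
                intro P _
                linarith [Real.add_one_le_exp (idN K s P.asIdeal)]
            _ = Real.exp (∑ P ∈ U, idN K s P.asIdeal) := (Real.exp_sum _ _).symm
            _ ≤ _ := Real.exp_le_exp.mpr
                ((prS_summable K hs).sum_le_tsum _ fun _ _ => idN_nonneg K _ _)
        · calc ∑ I ∈ JJ, idN K (2 * s) I ≤ ∑ I ∈ JJ, idN K 2 I :=
                sum_le_sum fun I _ => idN_anti K (by norm_num) (by linarith) I
            _ ≤ _ := (hsum 2 (by norm_num)).sum_le_tsum _ fun _ _ => idN_nonneg K _ _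

lemma exp_le_aux {x : ℝ} (h0 : 0 ≤ x) (h1 : x ≤ 1) : Real.exp x ≤ (1 + x) * Real.exp (x ^ 2) := by
  have h2 := Real.abs_exp_sub_one_sub_id_le (x := x) (by rwa [abs_of_nonneg h0])
  have h3 := (abs_le.mp h2).2
  have h4 := Real.add_one_le_exp (x ^ 2)
  nlinarith [mul_le_mul_of_nonneg_left h4 (show 0 ≤ 1 + x by linarith), pow_nonneg h0 3]

theorem le_zeta {s : ℝ} (hs : 1 < s) :
    Real.exp (prS K s) ≤ (∑' I, idN K s I) * Real.exp (∑' I, idN K 2 I) := by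
  classical
  have hsum := (zeta_tendsto K).1
  have hlim : Tendsto (fun U : Finset (HeightOneSpectrum (𝓞 K)) =>
      Real.exp (∑ P ∈ U, idN K s P.asIdeal)) atTop (𝓝 (Real.exp (prS K s))) :=
    (Real.continuous_exp.tendsto _).comp (prS_summable K hs).hasSum
  refine le_of_tendsto' hlim fun U => ?_
  calc Real.exp (∑ P ∈ U, idN K s P.asIdeal) = ∏ P ∈ U, Real.exp (idN K s P.asIdeal) :=
        Real.exp_sum _ _
    _ ≤ ∏ P ∈ U, ((1 + idN K s P.asIdeal) * Real.exp (idN K 2 P.asIdeal)) := by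
        refine prod_le_prod (fun _ _ => (Real.exp_pos _).le) fun P _ => ?_
        refine (exp_le_aux (idN_nonneg K s _) (idN_le_one K (by linarith) _)).trans ?_
        rw [idN_sq]
        have := idN_nonneg K s P.asIdeal
        gcongr
        exact idN_anti K (by norm_num) (by linarith) _
    _ = (∏ P ∈ U, (1 + idN K s P.asIdeal)) * Real.exp (∑ P ∈ U, idN K 2 P.asIdeal) := by
        rw [prod_mul_distrib, Real.exp_sum]
    _ = (∑ I ∈ U.powerset.image (fun A => ∏ P ∈ A, P.asIdeal), idN K s I) *
          Real.exp (∑ I ∈ U.image (fun P => P.asIdeal), idN K 2 I) := by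
        rw [prod_one_add, sum_image (fun _ _ _ _ h => prod_inj K h),
          sum_image (fun _ _ _ _ h => asIdeal_inj K h)]
        simp_rw [idN_prod]
    _ ≤ _ := by
        refine mul_le_mul ((hsum s hs).sum_le_tsum _ fun _ _ => idN_nonneg K _ _) ?_
          (Real.exp_pos _).le (tsum_nonneg fun _ => idN_nonneg K _ _)
        exact Real.exp_le_exp.mpr
          ((hsum 2 (by norm_num)).sum_le_tsum _ fun _ _ => idN_nonneg K _ _)

end ZetaPart2

end PartB

section PartC
open Finset Filter Topology NumberField IsDedekindDomain

noncomputable section ZetaPart3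
variable (K : Type*) [Field K] [NumberField K]

lemma absNorm_ne_zero' (P : HeightOneSpectrum (𝓞 K)) : Ideal.absNorm P.asIdeal ≠ 0 := by
  rw [Ne, Ideal.absNorm_eq_zero_iff]; exact P.ne_bot

lemma absNorm_ne_one' (P : HeightOneSpectrum (𝓞 K)) : Ideal.absNorm P.asIdeal ≠ 1 := by
  rw [Ne, Ideal.absNorm_eq_one_iff]; exact P.isPrime.ne_top

lemma exists_prime_mem (P : HeightOneSpectrum (𝓞 K)) :
    ∃ l : ℕ, l.Prime ∧ (l : 𝓞 K) ∈ P.asIdeal := by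
  have h : ((Ideal.absNorm P.asIdeal : ℕ) : 𝓞 K) ∈ P.asIdeal := Ideal.absNorm_mem _
  rw [← Nat.prod_primeFactorsList (absNorm_ne_zero' K P), Nat.cast_list_prod] at h
  have hp := P.isPrime
  have : ∀ L : List ℕ, (L.map (Nat.cast : ℕ → 𝓞 K)).prod ∈ P.asIdeal →
      ∃ l ∈ L, (l : 𝓞 K) ∈ P.asIdeal := by
    intro L
    induction L with
    | nil =>
      intro h; simp only [List.map_nil, List.prod_nil] at h
      exact absurd ((Ideal.eq_top_iff_one _).mpr h) hp.ne_top
    | cons a L ih =>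
      intro h
      simp only [List.map_cons, List.prod_cons] at h
      rcases hp.mem_or_mem h with h | h
      · exact ⟨a, by simp, h⟩
      · obtain ⟨l, hl, h⟩ := ih h
        exact ⟨l, by simp [hl], h⟩
  obtain ⟨l, hl, h⟩ := this _ h
  exact ⟨l, Nat.prime_of_mem_primeFactorsList hl, h⟩

/-- rational prime below `P` -/
def rp (P : HeightOneSpectrum (𝓞 K)) : ℕ := (exists_prime_mem K P).choose

lemma rp_prime (P : HeightOneSpectrum (𝓞 K)) : (rp K P).Prime := (exists_prime_mem K P).choose_spec.1
lemma rp_mem (P : HeightOneSpectrum (𝓞 K)) : (rp K P : 𝓞 K) ∈ P.asIdeal :=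
  (exists_prime_mem K P).choose_spec.2

lemma absNorm_span_nat (l : ℕ) :
    Ideal.absNorm (Ideal.span {(l : 𝓞 K)}) = l ^ Module.finrank ℚ K := by
  rw [Ideal.absNorm_span_singleton]
  have : (l : 𝓞 K) = algebraMap ℤ (𝓞 K) (l : ℤ) := by simp
  rw [this, Algebra.norm_algebraMap, RingOfIntegers.rank, Int.natAbs_pow, Int.natAbs_natCast]

lemma absNorm_pow (P : HeightOneSpectrum (𝓞 K)) :
    ∃ f, 1 ≤ f ∧ Ideal.absNorm P.asIdeal = rp K P ^ f := by
  have h : P.asIdeal ∣ Ideal.span {(rp K P : 𝓞 K)} :=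
    Ideal.dvd_span_singleton.mpr (rp_mem K P)
  have h := map_dvd Ideal.absNorm h
  rw [absNorm_span_nat] at h
  obtain ⟨f, -, hf⟩ := (Nat.dvd_prime_pow (rp_prime K P)).mp h
  refine ⟨f, ?_, hf⟩
  rcases Nat.eq_zero_or_pos f with rfl | h
  · exact absurd (by simpa using hf) (absNorm_ne_one' K P)
  · exact h

lemma card_fiber_le (F : Finset (HeightOneSpectrum (𝓞 K))) (l : ℕ) (hF : ∀ P ∈ F, rp K P = l) :
    #F ≤ Module.finrank ℚ K := by
  classical
  rcases F.eq_empty_or_nonempty with rfl | ⟨P0, hP0⟩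
  · simp
  have hl : l.Prime := hF P0 hP0 ▸ rp_prime K P0
  have h : ∏ P ∈ F, P.asIdeal ∣ Ideal.span {(l : 𝓞 K)} := by
    rw [← prod_image (s := F) (g := fun P => P.asIdeal) (f := fun I => I)
      (fun _ _ _ _ h => asIdeal_inj K h)]
    refine Finset.prod_primes_dvd _ ?_ ?_
    · intro I hI
      obtain ⟨P, -, rfl⟩ := mem_image.mp hI
      exact P.prime
    · intro I hI
      obtain ⟨P, hP, rfl⟩ := mem_image.mp hI
      rw [← hF P hP]
      exact Ideal.dvd_span_singleton.mpr (rp_mem K P)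
  have h := map_dvd Ideal.absNorm h
  rw [absNorm_span_nat, map_prod] at h
  have h := Nat.le_of_dvd (pow_pos hl.pos _) h
  have h2 : l ^ #F ≤ ∏ P ∈ F, Ideal.absNorm P.asIdeal := by
    rw [← prod_const]
    refine prod_le_prod' fun P hP => ?_
    obtain ⟨f, hf, he⟩ := absNorm_pow K P
    rw [he, hF P hP]
    exact Nat.le_self_pow (by omega) l
  exact (Nat.pow_le_pow_iff_right hl.one_lt).mp (h2.trans h)

/-- `∑_{l ∈ T} l^{-s}` -/
def tS (T : Set ℕ) (s : ℝ) : ℝ := ∑' l : ℕ, T.indicator (fun l => (l : ℝ) ^ (-s)) l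

lemma tS_summable (T : Set ℕ) {s : ℝ} (hs : 1 < s) :
    Summable (T.indicator (fun l : ℕ => (l : ℝ) ^ (-s))) :=
  (Real.summable_nat_rpow.mpr (by linarith)).indicator T

theorem prS_le (T : Set ℕ) (E : Finset ℕ)
    (h : ∀ P : HeightOneSpectrum (𝓞 K), ∀ l : ℕ, l.Prime → Ideal.absNorm P.asIdeal = l →
      l ∈ T ∨ l ∈ E) :
    ∃ C : ℝ, ∀ s : ℝ, 1 < s → prS K s ≤ Module.finrank ℚ K * tS T s + C := by
  classical
  let eI : ℕ → ℝ := fun l => if l ∈ E then 1 else 0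
  have heI : Summable eI := summable_of_ne_finset_zero (s := E) (by
    intro b hb; simp [eI, hb])
  have hsq : Summable (fun l : ℕ => (l : ℝ) ^ (-2 : ℝ)) :=
    Real.summable_nat_rpow.mpr (by norm_num)
  refine ⟨Module.finrank ℚ K * (∑' l, eI l + ∑' l : ℕ, (l : ℝ) ^ (-2 : ℝ)), fun s hs => ?_⟩
  let g : ℕ → ℝ := fun l => T.indicator (fun l => (l : ℝ) ^ (-s)) l + (eI l + (l : ℝ) ^ (-2 : ℝ))
  have hg0 : ∀ l, 0 ≤ g l := by
    intro l
    have : 0 ≤ T.indicator (fun l : ℕ => (l : ℝ) ^ (-s)) l :=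
      Set.indicator_nonneg (fun _ _ => by positivity) _
    have : 0 ≤ eI l := by simp only [eI]; split_ifs <;> norm_num
    have : 0 ≤ (l : ℝ) ^ (-2 : ℝ) := by positivity
    simp only [g]; linarith
  have hgs : Summable g := (tS_summable T hs).add (heI.add hsq)
  have hgt : ∑' l, g l = tS T s + (∑' l, eI l + ∑' l : ℕ, (l : ℝ) ^ (-2 : ℝ)) := by
    rw [(tS_summable T hs).tsum_add (heI.add hsq), heI.tsum_add hsq]; rfl
  rw [← mul_add, ← hgt]
  refine Real.tsum_le_of_sum_le (fun P => idN_nonneg K s _) fun F => ?_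
  have hle : ∀ P : HeightOneSpectrum (𝓞 K), idN K s P.asIdeal ≤ g (rp K P) := by
    intro P
    obtain ⟨f, hf, he⟩ := absNorm_pow K P
    have hl := rp_prime K P
    set l := rp K P with hldef
    have hl1 : (1 : ℝ) ≤ l := by exact_mod_cast hl.one_lt.le
    have h1 : 0 ≤ T.indicator (fun l : ℕ => (l : ℝ) ^ (-s)) l :=
      Set.indicator_nonneg (fun _ _ => by positivity) _
    have h2 : 0 ≤ eI l := by simp only [eI]; split_ifs <;> norm_num
    have h3 : 0 ≤ (l : ℝ) ^ (-2 : ℝ) := by positivity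
    simp only [g]
    by_cases hf1 : f = 1
    · subst hf1
      rw [pow_one] at he
      rcases h P l hl he with hT | hE
      · have : idN K s P.asIdeal = T.indicator (fun l : ℕ => (l : ℝ) ^ (-s)) l := by
          rw [Set.indicator_of_mem hT, idN, he]
        linarith
      · have : eI l = 1 := by simp [eI, hE]
        have := idN_le_one K (show 0 < s by linarith) P.asIdeal
        linarith
    · have : idN K s P.asIdeal ≤ (l : ℝ) ^ (-2 : ℝ) := by
        rw [idN, he]
        push_cast
        rw [← Real.rpow_natCast, ← Real.rpow_mul (by positivity)]
        apply Real.rpow_le_rpow_of_exponent_le hl1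
        have : (2 : ℝ) ≤ f := by exact_mod_cast (show 2 ≤ f by omega)
        nlinarith
      linarith
  calc ∑ P ∈ F, idN K s P.asIdeal ≤ ∑ P ∈ F, g (rp K P) := sum_le_sum fun P _ => hle P
    _ = ∑ l ∈ F.image (rp K), #{P ∈ F | rp K P = l} • g l := sum_comp g (rp K)
    _ ≤ ∑ l ∈ F.image (rp K), (Module.finrank ℚ K : ℝ) * g l := by
        refine sum_le_sum fun l _ => ?_
        rw [nsmul_eq_mul]
        refine mul_le_mul_of_nonneg_right ?_ (hg0 l)
        exact_mod_cast card_fiber_le K _ l (fun P hP => (mem_filter.mp hP).2)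
    _ = (Module.finrank ℚ K : ℝ) * ∑ l ∈ F.image (rp K), g l := by rw [mul_sum]
    _ ≤ _ := by
        gcongr
        exact hgs.sum_le_tsum _ fun _ _ => hg0 _

theorem le_prS (T : Set ℕ) (d : ℕ)
    (h : ∀ l ∈ T, ∃ F : Finset (HeightOneSpectrum (𝓞 K)),
      d ≤ #F ∧ ∀ P ∈ F, Ideal.absNorm P.asIdeal = l) {s : ℝ} (hs : 1 < s) :
    d * tS T s ≤ prS K s := by
  classical
  rw [tS, ← tsum_mul_left]
  refine Real.tsum_le_of_sum_le (fun l => mul_nonneg (by positivity)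
    (Set.indicator_nonneg (fun _ _ => by positivity) _)) fun U => ?_
  choose! F hF hFn using h
  let V := U.filter (· ∈ T)
  calc ∑ l ∈ U, (d : ℝ) * T.indicator (fun l => (l : ℝ) ^ (-s)) l
      = ∑ l ∈ V, (d : ℝ) * (l : ℝ) ^ (-s) := by
        rw [sum_filter]
        refine sum_congr rfl fun l _ => ?_
        by_cases hl : l ∈ T <;> simp [hl]
    _ ≤ ∑ l ∈ V, ∑ P ∈ F l, idN K s P.asIdeal := by
        refine sum_le_sum fun l hl => ?_
        have hl := (mem_filter.mp hl).2
        rw [sum_congr rfl (g := fun _ => (l : ℝ) ^ (-s)) (fun P hP => by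
          rw [idN, hFn l hl P hP]), sum_const, nsmul_eq_mul]
        gcongr
        exact hF l hl
    _ = ∑ P ∈ V.biUnion F, idN K s P.asIdeal := by
        rw [sum_biUnion]
        intro l hl l' hl' hne
        refine Finset.disjoint_left.mpr fun P hP hP' => hne ?_
        rw [← hFn l (mem_filter.mp hl).2 P hP, hFn l' (mem_filter.mp hl').2 P hP']
    _ ≤ _ := (prS_summable K hs).sum_le_tsum _ fun _ _ => idN_nonneg K _ _

end ZetaPart3

/-- The abstract comparison of two number fields. -/
theorem finrank_le_of_split (K L : Type*) [Field K] [NumberField K] [Field L] [NumberField L]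
    (T : Set ℕ) (E : Finset ℕ)
    (hK : ∀ P : HeightOneSpectrum (𝓞 K), ∀ l : ℕ, l.Prime → Ideal.absNorm P.asIdeal = l →
      l ∈ T ∨ l ∈ E)
    (hL : ∀ l ∈ T, ∃ F : Finset (HeightOneSpectrum (𝓞 L)),
      Module.finrank ℚ L ≤ #F ∧ ∀ P ∈ F, Ideal.absNorm P.asIdeal = l) :
    Module.finrank ℚ L ≤ Module.finrank ℚ K := by
  by_contra hlt
  push Not at hlt
  obtain ⟨C, hC⟩ := prS_le K T E hK
  obtain ⟨hsK, htK⟩ := zeta_tendsto K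
  obtain ⟨hsL, htL⟩ := zeta_tendsto L
  set a := Module.finrank ℚ K
  set b := Module.finrank ℚ L
  set κK := dedekindZeta_residue K
  set κL := dedekindZeta_residue L
  have hκK : 0 < κK := dedekindZeta_residue_pos K
  set cK := ∑' I, idN K 2 I
  set cL := Real.exp (∑' I, idN L 2 I)
  have ha : 0 < a := Module.finrank_pos
  have hcK : 0 ≤ cK := tsum_nonneg fun _ => idN_nonneg K _ _
  -- bounds
  have h1 : ∀ s : ℝ, 1 < s → ∑' I, idN K s I ≤ Real.exp (a * tS T s + C) * cK := by
    intro s hs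
    refine (zeta_le K hs).trans ?_
    gcongr
    exact hC s hs
  have h2 : ∀ s : ℝ, 1 < s → Real.exp (b * tS T s) ≤ (∑' I, idN L s I) * cL := by
    intro s hs
    refine le_trans ?_ (le_zeta L hs)
    gcongr
    exact le_prS L T b hL hs
  -- combine : (s-1)ζ_K ≤ (s-1) e^{C} cK e^{a t}, and e^{(a+1) t} (s-1) bounded
  set D := Real.exp C * cK
  have hD : 0 ≤ D := by positivity
  have h3 : ∀ s : ℝ, 1 < s → ((s - 1) * ∑' I, idN K s I) ^ (a + 1) ≤
      (s - 1) * (D * (D * cL * ((s - 1) * ∑' I, idN L s I)) ^ a) := by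
    intro s hs
    have h1 := h1 s hs
    have h2 := h2 s hs
    set Z := ∑' I, idN K s I
    set Y := ∑' I, idN L s I
    set t := tS T s
    have ht : 0 ≤ t := tsum_nonneg fun _ => Set.indicator_nonneg (fun _ _ => by positivity) _
    have hZ : 0 ≤ Z := tsum_nonneg fun _ => idN_nonneg K _ _
    have hY : 0 ≤ Y := tsum_nonneg fun _ => idN_nonneg L _ _
    have hu : 0 ≤ s - 1 := by linarith
    have h1' : Z ≤ D * Real.exp t ^ a := by
      rw [← Real.exp_nat_mul]
      refine h1.trans (le_of_eq ?_)
      rw [Real.exp_add]; simp only [D]; ring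
    have h4 : Real.exp t ^ (a + 1) ≤ Y * cL := by
      rw [← Real.exp_nat_mul]
      refine le_trans (Real.exp_le_exp.mpr ?_) h2
      gcongr
      exact_mod_cast hlt
    have h5 : Z * Real.exp t ≤ D * cL * Y := by
      calc Z * Real.exp t ≤ (D * Real.exp t ^ a) * Real.exp t := by gcongr
        _ = D * Real.exp t ^ (a + 1) := by ring
        _ ≤ D * (Y * cL) := by gcongr
        _ = _ := by ring
    calc ((s - 1) * Z) ^ (a + 1) = (s - 1) * (((s - 1) * Z) ^ a * Z) := by ring
      _ ≤ (s - 1) * (((s - 1) * Z) ^ a * (D * Real.exp t ^ a)) := by gcongr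
      _ = (s - 1) * (D * ((s - 1) * (Z * Real.exp t)) ^ a) := by
          rw [mul_pow (s - 1) (Z * _), mul_pow Z, mul_pow (s - 1) Z]; ring
      _ ≤ (s - 1) * (D * ((s - 1) * (D * cL * Y)) ^ a) := by gcongr
      _ = _ := by ring
  have l1 := htK.pow (a + 1)
  have l0 : Tendsto (fun s : ℝ => s - 1) (𝓝[>] 1) (𝓝 0) := by
    refine tendsto_nhdsWithin_of_tendsto_nhds ?_
    have : Tendsto (fun s : ℝ => s - 1) (𝓝 1) (𝓝 (1 - 1)) :=
      (continuous_id.sub continuous_const).tendsto 1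
    simpa using this
  have l2 := l0.mul (((htL.const_mul (D * cL)).pow a).const_mul D)
  have := le_of_tendsto_of_tendsto l1 l2 (by
    filter_upwards [self_mem_nhdsWithin] with s hs using h3 s hs)
  rw [zero_mul] at this
  have : 0 < κK ^ (a + 1) := by positivity
  linarith

end PartC

section PartD
open Finset NumberField IsDedekindDomain

/-- `L` is the Galois field generated by all `q`-th roots of the elements of `A`. -/
structure IsRad (q : ℕ) (A : Finset ℤ) (L : Type*) [Field L] [NumberField L] : Prop where
  gal : IsGalois ℚ L
  gen : ∀ σ τ : L ≃ₐ[ℚ] L, (∀ a ∈ A, ∀ x : L, x ^ q = (a : L) → σ x = τ x) → σ = τ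
  root : ∀ a ∈ A, ∃ x : L, x ^ q = (a : L)
  zeta : ∃ ζ : L, IsPrimitiveRoot ζ q

lemma card_le_of_pow {R : Type*} [CommRing R] [IsDomain R] [Fintype R] {l : ℕ} (hl : 1 < l)
    (h : ∀ x : R, x ^ l = x) : Fintype.card R ≤ l := by
  classical
  have hne : (Polynomial.X ^ l - Polynomial.X : Polynomial R) ≠ 0 :=
    by
    intro h0
    have h1 := congrArg (fun p => Polynomial.coeff p l) h0
    have h2 : l ≠ 1 := by omega
    simp [Polynomial.coeff_X, h2, h2.symm] at h1
  have h1 : (univ : Finset R) ⊆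
      (Polynomial.X ^ l - Polynomial.X : Polynomial R).roots.toFinset := by
    intro x _
    rw [Multiset.mem_toFinset, Polynomial.mem_roots hne]
    simp [h x]
  calc Fintype.card R = #(univ : Finset R) := rfl
    _ ≤ _ := card_le_card h1
    _ ≤ _ := Multiset.toFinset_card_le _
    _ ≤ _ := Polynomial.card_roots' _
    _ ≤ l := by
      refine (Polynomial.natDegree_sub_le _ _).trans ?_
      simp; omega

section RadSplit
variable {q : ℕ} {L : Type*} [Field L] [NumberField L]

lemma exists_int_of_pow_eq (hq : 0 < q) (a : ℤ) (x : L) (hx : x ^ q = (a : L)) :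
    ∃ y : 𝓞 L, (y : L) = x ∧ y ^ q = (a : 𝓞 L) := by
  have hint : IsIntegral ℤ x := by
    apply IsIntegral.of_pow hq
    rw [hx]
    exact isIntegral_algebraMap (R := ℤ) (x := a)
  let y : 𝓞 L := ⟨x, hint⟩
  have hyx : (y : L) = x := rfl
  refine ⟨y, hyx, ?_⟩
  apply RingOfIntegers.coe_injective
  have h1 : ((y ^ q : 𝓞 L) : L) = (y : L) ^ q := map_pow (algebraMap (𝓞 L) L) y q
  have h2 : (((a : 𝓞 L)) : L) = (a : L) := map_intCast (algebraMap (𝓞 L) L) a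
  exact h1.trans ((by rw [hyx, hx] : (y : L) ^ q = (a : L)).trans h2.symm)

/-- an integer is in `P ∋ l` iff divisible by `l` -/
lemma int_mem_iff (P : Ideal (𝓞 L)) (hP : P ≠ ⊤) {l : ℕ} (hl : l.Prime)
    (hlP : (l : 𝓞 L) ∈ P) (n : ℤ) : (n : 𝓞 L) ∈ P ↔ (l : ℤ) ∣ n := by
  constructor
  · intro hn
    by_contra hnd
    have hc : IsCoprime (l : ℤ) n :=
      (Prime.coprime_iff_not_dvd (Nat.prime_iff_prime_int.mp hl)).mpr hnd
    obtain ⟨u, v, h⟩ := hc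
    apply hP
    rw [Ideal.eq_top_iff_one]
    have : (1 : 𝓞 L) = (u : 𝓞 L) * (l : 𝓞 L) + (v : 𝓞 L) * (n : 𝓞 L) := by
      have := congrArg (Int.cast : ℤ → 𝓞 L) h
      push_cast at this
      exact this.symm
    rw [this]
    exact P.add_mem (P.mul_mem_left _ hlP) (P.mul_mem_left _ hn)
  · rintro ⟨m, rfl⟩
    push_cast
    exact P.mul_mem_right _ hlP

lemma root_inj (P : Ideal (𝓞 L)) [hPp : P.IsPrime] (hq : q.Prime) {l : ℕ} (hl : l.Prime)
    (hlP : (l : 𝓞 L) ∈ P) (hlq : l ≠ q) (a : ℤ) (ha : ¬ (l : ℤ) ∣ a) (x y : 𝓞 L)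
    (hx : x ^ q = (a : 𝓞 L)) (hy : y ^ q = (a : 𝓞 L)) (hxy : x - y ∈ P) : x = y := by
  by_contra hne
  have hg := (Commute.all x y).geom_sum₂_mul q
  rw [hx, hy, sub_self] at hg
  have h0 : ∑ i ∈ range q, x ^ i * y ^ (q - 1 - i) = 0 :=
    (mul_eq_zero.mp hg).resolve_right (sub_ne_zero.mpr hne)
  have hmk : Ideal.Quotient.mk P x = Ideal.Quotient.mk P y := Ideal.Quotient.eq.mpr hxy
  have h1 := congrArg (Ideal.Quotient.mk P) h0
  rw [map_sum, map_zero] at h1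
  have h2 : ∀ i ∈ range q, Ideal.Quotient.mk P (x ^ i * y ^ (q - 1 - i)) =
      Ideal.Quotient.mk P (x ^ (q - 1)) := by
    intro i hi
    rw [map_mul, map_pow, map_pow, ← hmk, ← pow_add, map_pow]
    congr 1
    have := mem_range.mp hi
    omega
  rw [sum_congr rfl h2, sum_const, card_range, nsmul_eq_mul, ← map_natCast (Ideal.Quotient.mk P),
    ← map_mul, Ideal.Quotient.eq_zero_iff_mem] at h1
  rcases hPp.mem_or_mem h1 with h | h
  · have := (int_mem_iff P hPp.ne_top hl hlP (q : ℤ)).mp (by exact_mod_cast h)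
    have := (Nat.prime_dvd_prime_iff_eq hl hq).mp (by exact_mod_cast this)
    exact hlq this
  · have hxP : x ∈ P := hPp.mem_of_pow_mem _ h
    have : (a : 𝓞 L) ∈ P := by
      rw [← hx]; exact P.pow_mem_of_mem hxP q hq.pos
    exact ha ((int_mem_iff P hPp.ne_top hl hlP a).mp this)

/-- degree one primes give residues -/
theorem residue_of_absNorm {A : Finset ℤ} (hL : IsRad q A L) (hq : q.Prime)
    (P : HeightOneSpectrum (𝓞 L)) {l : ℕ} (hl : l.Prime) (hP : Ideal.absNorm P.asIdeal = l)
    (hlq : l ≠ q) : q ∣ l - 1 ∧ ∀ a ∈ A, ∃ y : ZMod l, y ^ q = (a : ZMod l) := by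
  have hPp := P.isPrime
  have hfin : Finite (𝓞 L ⧸ P.asIdeal) := by
    apply Nat.finite_of_card_ne_zero
    rw [← Submodule.cardQuot_apply, ← Ideal.absNorm_apply, hP]; exact hl.ne_zero
  have := Fintype.ofFinite (𝓞 L ⧸ P.asIdeal)
  have hcard : Fintype.card (𝓞 L ⧸ P.asIdeal) = l := by
    rw [← Nat.card_eq_fintype_card, ← Submodule.cardQuot_apply, ← Ideal.absNorm_apply, hP]
  let e := ZMod.ringEquivOfPrime (𝓞 L ⧸ P.asIdeal) hl hcard
  let f : 𝓞 L →+* ZMod l := e.symm.toRingHom.comp (Ideal.Quotient.mk P.asIdeal)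
  have hf : ∀ x, f x = 0 ↔ x ∈ P.asIdeal := by
    intro x
    simp only [f, RingHom.comp_apply]
    rw [← Ideal.Quotient.eq_zero_iff_mem]
    exact map_eq_zero_iff e.symm e.symm.injective
  have := Fact.mk hl
  have hlP : (l : 𝓞 L) ∈ P.asIdeal := by rw [← hf, map_natCast]; simp
  constructor
  · obtain ⟨ζ, hζ⟩ := hL.zeta
    obtain ⟨z, hz, hzq⟩ := exists_int_of_pow_eq hq.pos 1 ζ (by rw [hζ.pow_eq_one]; simp)
    have hz1 : f z ≠ 1 := by
      intro h
      have : z - 1 ∈ P.asIdeal := by rw [← hf, map_sub, h, map_one, sub_self]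
      have := root_inj P.asIdeal hq hl hlP hlq 1 (by
        intro h; exact hl.one_lt.ne' (by exact_mod_cast Int.eq_one_of_dvd_one (by positivity) h))
        z 1 hzq (by simp) this
      rw [this] at hz
      exact hζ.ne_one hq.one_lt (by rw [← hz]; simp)
    have hfq : f z ^ q = 1 := by rw [← map_pow, hzq]; simp
    have := Fact.mk hq
    have ho : orderOf (f z) = q := orderOf_eq_prime hfq hz1
    rw [← ho]
    apply orderOf_dvd_of_pow_eq_one
    apply ZMod.pow_card_sub_one_eq_one
    intro h0
    rw [h0, zero_pow hq.ne_zero] at hfq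
    exact zero_ne_one hfq
  · intro a ha
    obtain ⟨x, hx⟩ := hL.root a ha
    obtain ⟨y, -, hy⟩ := exists_int_of_pow_eq hq.pos a x hx
    exact ⟨f y, by rw [← map_pow, hy, map_intCast]⟩

lemma absNorm_eq_of_residue {A : Finset ℤ} (hL : IsRad q A L) (hq : q.Prime)
    (P : HeightOneSpectrum (𝓞 L)) {l : ℕ} (hl : l.Prime) (hlP : (l : 𝓞 L) ∈ P.asIdeal)
    (hlq : l ≠ q) (hl1 : q ∣ l - 1) (hA : ∀ a ∈ A, ¬ (l : ℤ) ∣ a)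
    (hr : ∀ a ∈ A, ∃ y : ZMod l, y ^ q = (a : ZMod l)) :
    Ideal.absNorm P.asIdeal = l := by
  have hPp := P.isPrime
  have hgal := hL.gal
  have hfin : Finite (𝓞 L ⧸ P.asIdeal) := by
    apply Nat.finite_of_card_ne_zero
    rw [← Submodule.cardQuot_apply, ← Ideal.absNorm_apply]; exact absNorm_ne_zero' L P
  have hF := Fact.mk hl
  obtain ⟨σ, hσ⟩ := IsArithFrobAt.exists_of_isInvariant ℤ (L ≃ₐ[ℚ] L) P.asIdeal
  have hunder : P.asIdeal.under ℤ = Ideal.span {(l : ℤ)} := by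
    ext n
    rw [Ideal.mem_span_singleton, ← int_mem_iff P.asIdeal hPp.ne_top hl hlP n]
    rfl
  have hcardl : Nat.card (ℤ ⧸ P.asIdeal.under ℤ) = l := by
    rw [hunder]
    rw [← Submodule.cardQuot_apply, ← Ideal.absNorm_apply, Ideal.absNorm_span_singleton]
    simp
  have hfrob : ∀ x : 𝓞 L, σ • x - x ^ l ∈ P.asIdeal := by
    intro x
    have := hσ x
    rwa [hcardl] at this
  have hone : σ = 1 := by
    apply hL.gen
    intro a ha x hx
    obtain ⟨y, hyx, hy⟩ := exists_int_of_pow_eq hq.pos a x hx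
    obtain ⟨m, hm⟩ := hl1
    have hmem : y ^ l - y ∈ P.asIdeal := by
      have h1 : y ^ l - y = ((a ^ m - 1 : ℤ) : 𝓞 L) * y := by
        have : l = q * m + 1 := by have := hl.pos; omega
        rw [this, pow_succ, pow_mul, hy]; push_cast; ring
      rw [h1]
      apply P.asIdeal.mul_mem_right
      rw [int_mem_iff P.asIdeal hPp.ne_top hl hlP, ← ZMod.intCast_zmod_eq_zero_iff_dvd]
      obtain ⟨z, hz⟩ := hr a ha
      push_cast
      rw [← hz, ← pow_mul, ← hm, ZMod.pow_card_sub_one_eq_one, sub_self]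
      intro h0
      rw [h0, zero_pow hq.ne_zero] at hz
      exact hA a ha ((ZMod.intCast_zmod_eq_zero_iff_dvd a l).mp hz.symm)
    have h2 : σ • y - y ∈ P.asIdeal := by
      have := P.asIdeal.add_mem (hfrob y) hmem
      simpa using this
    have h3 : σ • y = y := root_inj P.asIdeal hq hl hlP hlq a (hA a ha) _ _
      (by rw [← smul_pow', hy]; exact map_intCast (MulSemiringAction.toRingHom (L ≃ₐ[ℚ] L) (𝓞 L) σ) a) hy h2
    have h4 : ((σ • y : 𝓞 L) : L) = (y : L) := congrArg (fun t : 𝓞 L => (t : L)) h3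
    have h5 : ((σ • y : 𝓞 L) : L) = σ (y : L) := rfl
    rw [h5, hyx] at h4
    simpa using h4
  have hpow : ∀ x : 𝓞 L ⧸ P.asIdeal, x ^ l = x := by
    intro x
    obtain ⟨x, rfl⟩ := Ideal.Quotient.mk_surjective x
    have := hfrob x
    rw [hone, one_smul] at this
    rw [← map_pow]
    exact (Ideal.Quotient.eq.mpr this).symm
  have := Fintype.ofFinite (𝓞 L ⧸ P.asIdeal)
  have hle : Fintype.card (𝓞 L ⧸ P.asIdeal) ≤ l := card_le_of_pow hl.one_lt hpow
  have hle : Ideal.absNorm P.asIdeal ≤ l := by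
    rwa [Ideal.absNorm_apply, Submodule.cardQuot_apply, Nat.card_eq_fintype_card]
  have h : P.asIdeal ∣ Ideal.span {(l : 𝓞 L)} := Ideal.dvd_span_singleton.mpr hlP
  have h := map_dvd Ideal.absNorm h
  rw [absNorm_span_nat] at h
  obtain ⟨f, -, hf⟩ := (Nat.dvd_prime_pow hl).mp h
  rcases f with _ | f
  · exact absurd (by simpa using hf) (absNorm_ne_one' L P)
  · refine le_antisymm hle ?_
    rw [hf]; exact Nat.le_self_pow (by omega) l

theorem split_of_residue {A : Finset ℤ} (hL : IsRad q A L) (hq : q.Prime)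
    {l : ℕ} (hl : l.Prime) (hlq : l ≠ q) (hl1 : q ∣ l - 1) (hA : ∀ a ∈ A, ¬ (l : ℤ) ∣ a)
    (hr : ∀ a ∈ A, ∃ y : ZMod l, y ^ q = (a : ZMod l)) :
    ∃ F : Finset (HeightOneSpectrum (𝓞 L)),
      Module.finrank ℚ L ≤ #F ∧ ∀ P ∈ F, Ideal.absNorm P.asIdeal = l := by
  classical
  have hgal := hL.gal
  have hF := Fact.mk hl
  have hnt : Ideal.span {(l : 𝓞 L)} ≠ ⊤ := by
    rw [Ne, ← Ideal.absNorm_eq_one_iff, absNorm_span_nat, Nat.pow_eq_one]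
    have : 0 < Module.finrank ℚ L := Module.finrank_pos
    have := hl.one_lt
    omega
  obtain ⟨m, hm, hlm⟩ := Ideal.exists_le_maximal _ hnt
  have hlm : (l : 𝓞 L) ∈ m := hlm (Ideal.mem_span_singleton_self _)
  have hmb : m ≠ ⊥ := by
    rintro rfl
    have : (l : 𝓞 L) = 0 := by simpa using hlm
    exact hl.ne_zero (by exact_mod_cast this)
  let τ : (L ≃ₐ[ℚ] L) → (𝓞 L ≃+* 𝓞 L) := fun σ => MulSemiringAction.toRingEquiv _ (𝓞 L) σ
  let Q : (L ≃ₐ[ℚ] L) → HeightOneSpectrum (𝓞 L) := fun σ =>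
    ⟨m.comap (τ σ), Ideal.IsPrime.comap (τ σ), by
      intro h
      have : (l : 𝓞 L) ∈ m.comap (τ σ) := by
        rw [Ideal.mem_comap, map_natCast]; exact hlm
      rw [h] at this
      have : (l : 𝓞 L) = 0 := by simpa using this
      exact hl.ne_zero (by exact_mod_cast this)⟩
  have hQl : ∀ σ, (l : 𝓞 L) ∈ (Q σ).asIdeal := by
    intro σ
    change (l : 𝓞 L) ∈ m.comap (τ σ)
    rw [Ideal.mem_comap, map_natCast]; exact hlm
  let P : HeightOneSpectrum (𝓞 L) := ⟨m, hm.isPrime, hmb⟩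
  have hPn : Ideal.absNorm m = l := absNorm_eq_of_residue hL hq P hl hlm hlq hl1 hA hr
  -- every element congruent to an integer mod m
  have hcong : ∀ x : 𝓞 L, ∃ n : ℤ, x - n ∈ m := by
    have hfin : Finite (𝓞 L ⧸ m) := by
      apply Nat.finite_of_card_ne_zero
      rw [← Submodule.cardQuot_apply, ← Ideal.absNorm_apply, hPn]; exact hl.ne_zero
    have := Fintype.ofFinite (𝓞 L ⧸ m)
    have hcard : Fintype.card (𝓞 L ⧸ m) = l := by
      rw [← Nat.card_eq_fintype_card, ← Submodule.cardQuot_apply, ← Ideal.absNorm_apply, hPn]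
    let e := ZMod.ringEquivOfPrime (𝓞 L ⧸ m) hl hcard
    intro x
    refine ⟨((e.symm (Ideal.Quotient.mk m x)).val : ℤ), ?_⟩
    rw [← Ideal.Quotient.eq]
    have : e ((e.symm (Ideal.Quotient.mk m x)).val : ZMod l) = Ideal.Quotient.mk m x := by
      rw [ZMod.natCast_zmod_val, RingEquiv.apply_symm_apply]
    rw [map_natCast] at this
    rw [Int.cast_natCast, map_natCast]
    exact this.symm
  have hinj : Function.Injective Q := by
    intro σ σ' h
    have h : m.comap (τ σ) = m.comap (τ σ') := congrArg HeightOneSpectrum.asIdeal h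
    apply hL.gen
    intro a ha x hx
    obtain ⟨y, hyx, hy⟩ := exists_int_of_pow_eq hq.pos a x hx
    obtain ⟨n, hn⟩ := hcong (τ σ y)
    have h1 : y - n ∈ m.comap (τ σ) := by
      rw [Ideal.mem_comap, map_sub, map_intCast]; exact hn
    rw [h, Ideal.mem_comap, map_sub, map_intCast] at h1
    have h2 : τ σ y - τ σ' y ∈ m := by
      have := m.sub_mem hn h1
      simpa using this
    have hmp := hm.isPrime
    have h3 : τ σ y = τ σ' y := root_inj m hq hl hlm hlq a (hA a ha) _ _
      (by rw [← map_pow, hy, map_intCast]) (by rw [← map_pow, hy, map_intCast]) h2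
    have h4 : ((τ σ y : 𝓞 L) : L) = ((τ σ' y : 𝓞 L) : L) := congrArg (fun t : 𝓞 L => (t : L)) h3
    have h5 : ∀ σ : L ≃ₐ[ℚ] L, ((τ σ y : 𝓞 L) : L) = σ (y : L) := fun _ => rfl
    rwa [h5, h5, hyx] at h4
  refine ⟨univ.image Q, ?_, ?_⟩
  · rw [card_image_of_injective _ hinj, card_univ, ← Nat.card_eq_fintype_card,
      IsGalois.card_aut_eq_finrank]
  · intro R hR
    obtain ⟨σ, -, rfl⟩ := mem_image.mp hR
    exact absNorm_eq_of_residue hL hq _ hl (hQl σ) hlq hl1 hA hr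

end RadSplit

end PartD

section PartE
open Finset NumberField IsDedekindDomain

section Kummer
open IntermediateField

theorem kummer {q : ℕ} {L : Type*} [Field L] [NumberField L] {A : Finset ℤ}
    (hL : IsRad q A L) (hq : q.Prime) (hA : ∀ a ∈ A, a ≠ 0) (b : ℤ) (hb : b ≠ 0) (β : L)
    (hβ : β ^ q = (b : L)) :
    ∃ (c : A → ℕ) (m : ℕ) (r : ℚ), ¬ q ∣ m ∧
      (∏ a : A, ((a : ℤ) : ℚ) ^ c a) * (b : ℚ) ^ m = r ^ q := by
  classical
  have hgal := hL.gal
  have hF := Fact.mk hq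
  obtain ⟨ζ, hζ⟩ := hL.zeta
  choose α hα using fun a : A => hL.root a.1 a.2
  let w : Option A → ℤ := fun i => i.elim b (fun a => a.1)
  let α' : Option A → L := fun i => i.elim β α
  have hw : ∀ i, w i ≠ 0 := by
    rintro (_ | a)
    · exact hb
    · exact hA _ a.2
  have hα' : ∀ i, α' i ^ q = (w i : L) := by
    rintro (_ | a)
    · exact hβ
    · exact hα a
  have hα0 : ∀ i, α' i ≠ 0 := by
    intro i h
    have := hα' i
    rw [h, zero_pow hq.ne_zero] at this
    exact hw i (by exact_mod_cast this.symm)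
  have hex : ∀ (σ : L ≃ₐ[ℚ] L) (i : Option A), ∃ e : ℕ, σ (α' i) = ζ ^ e * α' i := by
    intro σ i
    have h1 : (σ (α' i) / α' i) ^ q = 1 := by
      rw [div_pow, ← map_pow, hα', map_intCast, div_self]
      exact_mod_cast hw i
    have : NeZero q := ⟨hq.ne_zero⟩
    obtain ⟨e, -, he⟩ := hζ.eq_pow_of_pow_eq_one h1
    exact ⟨e, by rw [he, div_mul_cancel₀ _ (hα0 i)]⟩
  choose e he using hex
  have hzpow : ∀ m n : ℕ, ζ ^ m = ζ ^ n ↔ (m : ZMod q) = n := by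
    intro m n
    have hu : IsUnit ζ := hζ.isUnit hq.ne_zero
    have := pow_eq_pow_iff_modEq (x := hu.unit) (n := m) (m := n)
    rw [ZMod.natCast_eq_natCast_iff, hζ.eq_orderOf]
    rw [← orderOf_units, IsUnit.unit_spec] at this
    rw [← this, Units.ext_iff]
    simp
  let G0 := (ℚ⟮ζ⟯).fixingSubgroup
  have hG0 : ∀ σ, σ ∈ G0 → σ ζ = ζ := by
    intro σ h
    exact (mem_fixingSubgroup_iff _ _).mp h ζ (mem_adjoin_simple_self ℚ ζ)
  let E : (L ≃ₐ[ℚ] L) → (Option A → ZMod q) := fun σ i => (e σ i : ZMod q)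
  have hE : ∀ σ i (n : ℕ), σ (α' i) = ζ ^ n * α' i → E σ i = n := by
    intro σ i n h
    rw [he] at h
    exact (hzpow _ _).mp (mul_right_cancel₀ (hα0 i) h)
  have hE1 : E 1 = 0 := by
    funext i
    rw [hE 1 i 0 (by simp)]; simp
  have hEmul : ∀ σ τ, σ ∈ G0 → E (σ * τ) = E σ + E τ := by
    intro σ τ hσ
    funext i
    rw [hE (σ * τ) i (e σ i + e τ i) ?_]
    · simp [E]
    · rw [AlgEquiv.mul_apply, he τ, map_mul, map_pow, hG0 σ hσ, he σ, pow_add]; ring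
  let V : Submodule (ZMod q) (Option A → ZMod q) :=
    { carrier := {v | ∃ σ ∈ G0, v = E σ}
      add_mem' := by
        rintro _ _ ⟨σ, hσ, rfl⟩ ⟨τ, hτ, rfl⟩
        exact ⟨σ * τ, G0.mul_mem hσ hτ, (hEmul σ τ hσ).symm⟩
      zero_mem' := ⟨1, G0.one_mem, hE1.symm⟩
      smul_mem' := by
        rintro c _ ⟨σ, hσ, rfl⟩
        have : ∀ n : ℕ, (n : ZMod q) • E σ = E (σ ^ n) := by
          intro n
          induction n with
          | zero => simp [hE1]
          | succ n ih =>
            rw [pow_succ, hEmul _ _ (G0.pow_mem hσ n), ← ih]; push_cast; rw [add_smul, one_smul]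
        refine ⟨σ ^ c.val, G0.pow_mem hσ _, ?_⟩
        rw [← this, ZMod.natCast_zmod_val] }
  have hnot : (Pi.single none 1 : Option A → ZMod q) ∉ V := by
    rintro ⟨σ, hσ, h⟩
    have h1 : σ = 1 := by
      apply hL.gen
      intro a ha x hx
      have h0 := congrFun h (some ⟨a, ha⟩)
      rw [Pi.single_eq_of_ne (by simp)] at h0
      have h2 : σ (α ⟨a, ha⟩) = α ⟨a, ha⟩ := by
        have h3 := he σ (some ⟨a, ha⟩)
        have h4 : ζ ^ (e σ (some ⟨a, ha⟩)) = ζ ^ 0 := (hzpow _ _).mpr (by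
          rw [Nat.cast_zero]; exact h0.symm)
        rw [h4, pow_zero, one_mul] at h3
        exact h3
      have hne : α ⟨a, ha⟩ ≠ 0 := hα0 (some ⟨a, ha⟩)
      have h1 : (x / α ⟨a, ha⟩) ^ q = 1 := by
        rw [div_pow, hα, hx, div_self]
        exact_mod_cast hA a ha
      have : NeZero q := ⟨hq.ne_zero⟩
      obtain ⟨j, -, hj⟩ := hζ.eq_pow_of_pow_eq_one h1
      have hx' : x = ζ ^ j * α ⟨a, ha⟩ := by rw [hj, div_mul_cancel₀ _ hne]
      rw [hx', map_mul, map_pow, hG0 σ hσ, h2]; rfl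
    rw [h1, hE1] at h
    have := congrFun h none
    simp at this
  obtain ⟨f, hf0, hfV⟩ := Submodule.exists_le_ker_of_notMem hnot
  let d : Option A → ℕ := fun i => (f (Pi.single i 1)).val
  let γ : L := ∏ i, α' i ^ d i
  have hγfix : ∀ σ ∈ G0, σ γ = γ := by
    intro σ hσ
    have h1 : σ γ = ζ ^ (∑ i, e σ i * d i) * γ := by
      simp only [γ]
      rw [map_prod, ← prod_pow_eq_pow_sum, ← prod_mul_distrib]
      apply prod_congr rfl
      intro i _
      rw [map_pow, he, mul_pow, pow_mul]
    have h2 : ((∑ i, e σ i * d i : ℕ) : ZMod q) = 0 := by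
      have h3 : f (E σ) = 0 := hfV ⟨σ, hσ, rfl⟩
      have h4 : E σ = ∑ i, E σ i • (Pi.single i 1 : Option A → ZMod q) := by
        funext j
        simp [Finset.sum_apply, Pi.single_apply]
      rw [h4, map_sum] at h3
      push_cast
      rw [← h3]
      apply sum_congr rfl
      intro i _
      rw [map_smul, smul_eq_mul]
      simp only [d, ZMod.natCast_zmod_val]
      rfl
    have h5 : ζ ^ (∑ i, e σ i * d i) = ζ ^ 0 := (hzpow _ _).mpr (by rw [h2]; simp)
    rw [h1, h5, pow_zero, one_mul]
  have hγmem : γ ∈ ℚ⟮ζ⟯ := by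
    rw [← IsGalois.fixedField_fixingSubgroup (ℚ⟮ζ⟯), IntermediateField.mem_fixedField_iff]
    exact hγfix
  have hγq : γ ^ q = ((∏ i, (w i : ℚ) ^ d i : ℚ) : L) := by
    simp only [γ]
    rw [← prod_pow]
    push_cast
    apply prod_congr rfl
    intro i _
    rw [← pow_mul, mul_comm, pow_mul, hα']
  have hfr : Module.finrank ℚ ℚ⟮ζ⟯ = q - 1 := by
    have hint : IsIntegral ℚ ζ := hζ.isIntegral hq.pos |>.tower_top
    rw [IntermediateField.adjoin.finrank hint, ← Polynomial.cyclotomic_eq_minpoly_rat hζ hq.pos,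
      Polynomial.natDegree_cyclotomic, Nat.totient_prime hq]
  have hγ' : (⟨γ, hγmem⟩ : ℚ⟮ζ⟯) ^ q = algebraMap ℚ ℚ⟮ζ⟯ (∏ i, (w i : ℚ) ^ d i) := by
    apply Subtype.ext
    rw [SubmonoidClass.coe_pow]
    exact hγq.trans (eq_ratCast (algebraMap ℚ L) _).symm
  have hN := congrArg (Algebra.norm ℚ) hγ'
  rw [map_pow, Algebra.norm_algebraMap, hfr] at hN
  refine ⟨fun a => d (some a) * (q - 1), d none * (q - 1), Algebra.norm ℚ (⟨γ, hγmem⟩ : ℚ⟮ζ⟯), ?_, ?_⟩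
  rotate_left
  · rw [hN, Fintype.prod_option, mul_pow, mul_comm, ← prod_pow, ← pow_mul]
    congr 1
    apply prod_congr rfl
    intro a _
    rw [← pow_mul]
    rfl
  · intro h
    rcases (Nat.Prime.dvd_mul hq).mp h with h | h
    · apply hf0
      have := (ZMod.natCast_eq_zero_iff (d none) q).mpr h
      simpa [d] using this
    · have := Nat.le_of_dvd (by have := hq.two_le; omega) h
      have := hq.two_le
      omega

end Kummer

section Fields
open IntermediateField Polynomial

/-- the defining polynomial -/
noncomputable def radPoly (q : ℕ) (A : Finset ℤ) : ℚ[X] := ∏ a ∈ A, (X ^ q - C (a : ℚ))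

/-- the radical field -/
noncomputable def MF (q : ℕ) (A : Finset ℤ) : IntermediateField ℚ ℂ :=
  adjoin ℚ ((radPoly q A).rootSet ℂ)

variable {q : ℕ} {A : Finset ℤ}

lemma radPoly_ne (hq : 0 < q) : radPoly q A ≠ 0 :=
  prod_ne_zero_iff.mpr fun a _ => X_pow_sub_C_ne_zero hq _

lemma mem_radRoots (hq : 0 < q) (x : ℂ) :
    x ∈ (radPoly q A).rootSet ℂ ↔ ∃ a ∈ A, x ^ q = (a : ℂ) := by
  rw [mem_rootSet, and_iff_right (radPoly_ne hq), radPoly, map_prod, prod_eq_zero_iff]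
  simp [sub_eq_zero]

instance : FiniteDimensional ℚ (MF q A) := by
  have : IsSplittingField ℚ (MF q A) (radPoly q A) :=
    IntermediateField.adjoin_rootSet_isSplittingField
    (IsAlgClosed.splits ((radPoly q A).map (algebraMap ℚ ℂ)))
  exact Polynomial.IsSplittingField.finiteDimensional (MF q A) (radPoly q A)

instance : NumberField (MF q A) where

lemma MF_gal : IsGalois ℚ (MF q A) := by
  have : IsSplittingField ℚ (MF q A) (radPoly q A) :=
    IntermediateField.adjoin_rootSet_isSplittingField
    (IsAlgClosed.splits ((radPoly q A).map (algebraMap ℚ ℂ)))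
  have : Normal ℚ (MF q A) := Normal.of_isSplittingField (radPoly q A)
  exact { }

lemma MF_mem (hq : 0 < q) {a : ℤ} (ha : a ∈ A) {x : ℂ} (hx : x ^ q = (a : ℂ)) : x ∈ MF q A :=
  subset_adjoin _ _ ((mem_radRoots hq x).mpr ⟨a, ha, hx⟩)

lemma MF_isRad (hq : q.Prime) (h1 : (1 : ℤ) ∈ A) : IsRad q A (MF q A) where
  gal := MF_gal
  gen := by
    intro σ τ h
    have : (σ : MF q A →ₐ[ℚ] MF q A) = (τ : MF q A →ₐ[ℚ] MF q A) := by
      apply IntermediateField.algHom_ext_of_eq_adjoin _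
        (S := MF q A) (s := (radPoly q A).rootSet ℂ) rfl
      intro x hx
      obtain ⟨a, ha, hx'⟩ := (mem_radRoots hq.pos x).mp hx
      apply h a ha
      apply Subtype.ext
      simpa using hx'
    ext x
    exact congrArg Subtype.val (DFunLike.congr_fun this x)
  root := by
    intro a ha
    obtain ⟨x, hx⟩ := IsAlgClosed.exists_pow_nat_eq (a : ℂ) hq.pos
    refine ⟨⟨x, MF_mem hq.pos ha hx⟩, ?_⟩
    apply Subtype.ext
    simpa using hx
  zeta := by
    have h := Complex.isPrimitiveRoot_exp q hq.ne_zero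
    refine ⟨⟨_, MF_mem hq.pos h1 (x := Complex.exp (2 * Real.pi * Complex.I / q)) ?_⟩, ?_⟩
    · rw [h.pow_eq_one]; simp
    · exact IsPrimitiveRoot.of_map_of_injective (f := algebraMap (MF q A) ℂ) h
        (algebraMap (MF q A) ℂ).injective

lemma MF_root_of_finrank (hq : q.Prime) {B : Finset ℤ} (hAB : A ⊆ B)
    (h : Module.finrank ℚ (MF q B) ≤ Module.finrank ℚ (MF q A)) {b : ℤ} (hb : b ∈ B) :
    ∃ β : MF q A, β ^ q = (b : MF q A) := by
  have hle : MF q A ≤ MF q B := by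
    apply IntermediateField.adjoin.mono
    intro x hx
    obtain ⟨a, ha, hx⟩ := (mem_radRoots hq.pos x).mp hx
    exact (mem_radRoots hq.pos x).mpr ⟨a, hAB ha, hx⟩
  have heq := IntermediateField.eq_of_le_of_finrank_le hle h
  obtain ⟨x, hx⟩ := IsAlgClosed.exists_pow_nat_eq (b : ℂ) hq.pos
  refine ⟨⟨x, by rw [heq]; exact MF_mem hq.pos hb hx⟩, ?_⟩
  apply Subtype.ext
  simpa using hx

end Fields

end PartE

section PartF
open Finset NumberField IsDedekindDomain

/-- `q`-th power residues -/
def IsRes (q l a : ℕ) : Prop := ∃ y : ZMod l, y ^ q = (a : ZMod l)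

lemma isRes_iff {q l : ℕ} [Fact l.Prime] {a b t : ℕ} (h : a = b * t ^ q)
    (ht : (t : ZMod l) ≠ 0) : IsRes q l a ↔ IsRes q l b := by
  constructor
  · rintro ⟨y, hy⟩
    refine ⟨y / t, ?_⟩
    rw [div_pow, hy, h]
    push_cast
    rw [mul_div_cancel_right₀ _ (pow_ne_zero _ ht)]
  · rintro ⟨y, hy⟩
    refine ⟨y * t, ?_⟩
    rw [mul_pow, hy, h]
    push_cast
    rfl

lemma IsRes.mul {q l a b : ℕ} (ha : IsRes q l a) (hb : IsRes q l b) : IsRes q l (a * b) := by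
  obtain ⟨x, hx⟩ := ha
  obtain ⟨y, hy⟩ := hb
  exact ⟨x * y, by rw [mul_pow, hx, hy]; push_cast; rfl⟩

lemma IsRes.pow {q l a : ℕ} (ha : IsRes q l a) (n : ℕ) : IsRes q l (a ^ n) := by
  obtain ⟨x, hx⟩ := ha
  exact ⟨x ^ n, by rw [← pow_mul, mul_comm, pow_mul, hx]; push_cast; rfl⟩

section MV
variable {q n : ℕ} (p : Fin n → ℕ)

/-- the integer attached to an exponent vector -/
def mv (v : Fin n → ZMod q) : ℕ := ∏ j, p j ^ (v j).val

lemma prod_eq_mv (e : Fin n → ℕ) :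
    ∏ j, p j ^ e j = mv (q := q) p (fun j => (e j : ZMod q)) * (∏ j, p j ^ (e j / q)) ^ q := by
  rw [mv, ← prod_pow, ← prod_mul_distrib]
  apply prod_congr rfl
  intro j _
  rw [ZMod.val_natCast, ← pow_mul, ← pow_add]
  congr 1
  have := Nat.mod_add_div (e j) q
  rw [mul_comm (e j / q)]
  exact this.symm

lemma mv_add [NeZero q] (v w : Fin n → ZMod q) : ∃ e : Fin n → ℕ,
    mv p v * mv p w = mv p (v + w) * (∏ j, p j ^ e j) ^ q := by
  refine ⟨fun j => ((v j).val + (w j).val) / q, ?_⟩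
  have h := prod_eq_mv (q := q) p (fun j => (v j).val + (w j).val)
  have h2 : (fun j => (((v j).val + (w j).val : ℕ) : ZMod q)) = v + w := by
    funext j; push_cast; rw [ZMod.natCast_zmod_val, ZMod.natCast_zmod_val]; rfl
  rw [h2] at h
  rw [← h, mv, mv, ← prod_mul_distrib]
  simp_rw [pow_add]

lemma mv_smul [NeZero q] (c : ZMod q) (v : Fin n → ZMod q) : ∃ e : Fin n → ℕ,
    mv p v ^ c.val = mv p (c • v) * (∏ j, p j ^ e j) ^ q := by
  refine ⟨fun j => ((v j).val * c.val) / q, ?_⟩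
  have h := prod_eq_mv (q := q) p (fun j => (v j).val * c.val)
  have h2 : (fun j => (((v j).val * c.val : ℕ) : ZMod q)) = c • v := by
    funext j; push_cast; rw [ZMod.natCast_zmod_val, ZMod.natCast_zmod_val, mul_comm]; rfl
  rw [h2] at h
  rw [← h, mv, ← prod_pow]
  simp_rw [pow_mul]

lemma prod_ne_zmod {l : ℕ} (hl : l.Prime) (hpl : ∀ j, ¬ l ∣ p j) (e : Fin n → ℕ) :
    ((∏ j, p j ^ e j : ℕ) : ZMod l) ≠ 0 := by
  rw [Ne, ZMod.natCast_eq_zero_iff, hl.prime.dvd_finsetProd_iff]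
  rintro ⟨j, -, hj⟩
  exact hpl j (hl.dvd_of_dvd_pow hj)

/-- exponent vectors of residues -/
def resSub (hq : q.Prime) {l : ℕ} (hl : l.Prime) (hpl : ∀ j, ¬ l ∣ p j) :
    Submodule (ZMod q) (Fin n → ZMod q) where
  carrier := {v | IsRes q l (mv p v)}
  add_mem' := by
    intro v w hv hw
    have := Fact.mk hl
    have : NeZero q := ⟨hq.ne_zero⟩
    obtain ⟨e, he⟩ := mv_add p v w
    exact (isRes_iff he (prod_ne_zmod p hl hpl e)).mp (hv.mul hw)
  zero_mem' := ⟨1, by simp [mv]⟩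
  smul_mem' := by
    intro c v hv
    have := Fact.mk hl
    have : NeZero q := ⟨hq.ne_zero⟩
    obtain ⟨e, he⟩ := mv_smul p c v
    exact (isRes_iff he (prod_ne_zmod p hl hpl e)).mp (hv.pow _)

lemma fact_prod (hp : ∀ j, (p j).Prime) (hinj : Function.Injective p) (e : Fin n → ℕ) (i : Fin n) :
    (∏ j, p j ^ e j).factorization (p i) = e i := by
  rw [Nat.factorization_prod (fun j _ => pow_ne_zero _ (hp j).ne_zero), Finsupp.finsetSum_apply,
    sum_eq_single i]
  · rw [(hp i).factorization_pow]; simp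
  · intro j _ hj
    rw [(hp j).factorization_pow]
    exact Finsupp.single_eq_of_ne (fun h => hj (hinj h.symm))
  · simp

theorem exists_prime_nonres (hq : q.Prime) (hp : ∀ j, (p j).Prime) (hinj : Function.Injective p)
    (φ : (Fin n → ZMod q) →ₗ[ZMod q] ZMod q) (hφ : φ ≠ 0) {Δ : ℕ} (hΔ : 0 < Δ) :
    ∃ l : ℕ, l.Prime ∧ ¬ l ∣ Δ ∧ (∀ j, ¬ l ∣ p j) ∧
      ∀ v : Fin n → ZMod q, IsRes q l (mv p v) → φ v = 0 := by
  classical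
  have hF := Fact.mk hq
  by_contra! hcon
  have hmv0 : ∀ v : Fin n → ZMod q, mv p v ≠ 0 := fun v =>
    prod_ne_zero_iff.mpr fun j _ => pow_ne_zero _ (hp j).ne_zero
  let A : Finset ℤ := (univ.filter fun v : Fin n → ZMod q => φ v = 0).image fun v => (mv p v : ℤ)
  let B : Finset ℤ := (univ : Finset (Fin n → ZMod q)).image fun v => (mv p v : ℤ)
  have hAB : A ⊆ B := image_subset_image (filter_subset _ _)
  have h1A : (1 : ℤ) ∈ A := mem_image.mpr ⟨0, by simp, by simp [mv]⟩
  have hA0 : ∀ a ∈ A, a ≠ 0 := by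
    intro a ha
    obtain ⟨v, -, rfl⟩ := mem_image.mp ha
    exact_mod_cast hmv0 v
  have hD : q * Δ * ∏ j, p j ≠ 0 := by
    refine mul_ne_zero (mul_ne_zero hq.ne_zero hΔ.ne') (prod_ne_zero_iff.mpr fun j _ => (hp j).ne_zero)
  let E := (q * Δ * ∏ j, p j).primeFactors
  have hE : ∀ l : ℕ, l.Prime → l ∉ E → l ≠ q ∧ ¬ l ∣ Δ ∧ ∀ j, ¬ l ∣ p j := by
    intro l hl h
    have h' : ¬ l ∣ q * Δ * ∏ j, p j := fun h' => h (Nat.mem_primeFactors.mpr ⟨hl, h', hD⟩)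
    refine ⟨?_, ?_, ?_⟩
    · rintro rfl
      exact h' (Dvd.dvd.mul_right (Dvd.intro _ rfl) _)
    · intro h; exact h' (Dvd.dvd.mul_right (Dvd.dvd.mul_left h _) _)
    · intro j h; exact h' (Dvd.dvd.mul_left (h.trans (dvd_prod_of_mem p (mem_univ j))) _)
  let T : Set ℕ := {l | l.Prime ∧ l ∉ E ∧ q ∣ l - 1 ∧ ∀ v : Fin n → ZMod q, IsRes q l (mv p v)}
  have hRA := MF_isRad hq h1A
  have hRB := MF_isRad hq (hAB h1A)
  have hfin : Module.finrank ℚ (MF q B) ≤ Module.finrank ℚ (MF q A) := by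
    apply finrank_le_of_split (MF q A) (MF q B) T E
    · intro P l hl hP
      by_cases hlE : l ∈ E
      · exact Or.inr hlE
      left
      obtain ⟨hlq, hlΔ, hlp⟩ := hE l hl hlE
      obtain ⟨h1, h2⟩ := residue_of_absNorm hRA hq P hl hP hlq
      refine ⟨hl, hlE, h1, ?_⟩
      obtain ⟨v, hv, hφv⟩ := hcon l hl hlΔ hlp
      have hker : ∀ u, φ u = 0 → u ∈ resSub p hq hl hlp := by
        intro u hu
        obtain ⟨y, hy⟩ := h2 (mv p u : ℤ) (mem_image.mpr ⟨u, by simp [hu], rfl⟩)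
        exact ⟨y, by rw [hy]; push_cast; rfl⟩
      intro u
      have hu : u = (u - (φ u / φ v) • v) + (φ u / φ v) • v := by abel
      change u ∈ resSub p hq hl hlp
      rw [hu]
      refine Submodule.add_mem _ (hker _ ?_) (Submodule.smul_mem _ _ hv)
      rw [map_sub, map_smul, smul_eq_mul, div_mul_cancel₀ _ hφv, sub_self]
    · rintro l ⟨hl, hlE, hl1, hres⟩
      obtain ⟨hlq, hlΔ, hlp⟩ := hE l hl hlE
      apply split_of_residue hRB hq hl hlq hl1
      · intro b hb
        obtain ⟨v, -, rfl⟩ := mem_image.mp hb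
        intro h
        have h : l ∣ mv p v := by exact_mod_cast h
        exact prod_ne_zmod p hl hlp _ ((ZMod.natCast_eq_zero_iff _ _).mpr h)
      · intro b hb
        obtain ⟨v, -, rfl⟩ := mem_image.mp hb
        obtain ⟨y, hy⟩ := hres v
        exact ⟨y, by rw [hy]; push_cast; rfl⟩
  apply hφ
  suffices h : ∀ w, φ w = 0 from LinearMap.ext h
  intro w
  obtain ⟨β, hβ⟩ := MF_root_of_finrank hq hAB hfin
    (mem_image.mpr ⟨w, mem_univ _, rfl⟩ : (mv p w : ℤ) ∈ B)
  obtain ⟨c, m, r, hm, hr⟩ := kummer hRA hq hA0 (mv p w : ℤ) (by exact_mod_cast hmv0 w) β hβ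
  have hu : ∀ a : A, ∃ u : Fin n → ZMod q, φ u = 0 ∧ (mv p u : ℤ) = a := by
    rintro ⟨a, ha⟩
    obtain ⟨u, hu, h⟩ := mem_image.mp ha
    exact ⟨u, (mem_filter.mp hu).2, h⟩
  choose u hu0 hu using hu
  let e : Fin n → ℕ := fun j => (∑ a : A, (u a j).val * c a) + (w j).val * m
  have hprod : ((∏ j, p j ^ e j : ℕ) : ℚ) = r ^ q := by
    rw [← hr]
    have h1 : ∏ j, p j ^ e j = (∏ a : A, mv p (u a) ^ c a) * mv p w ^ m := by
      simp only [e, mv, pow_add, prod_mul_distrib]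
      congr 1
      · simp_rw [← prod_pow]
        rw [prod_comm]
        apply prod_congr rfl
        intro j _
        rw [← prod_pow_eq_pow_sum]
        simp_rw [pow_mul]
      · simp_rw [← prod_pow, pow_mul]
    rw [h1]
    push_cast
    congr 1
    apply prod_congr rfl
    intro a _
    rw [← hu a]; push_cast; rfl
  have hzero : ∀ j, (e j : ZMod q) = 0 := by
    intro j
    have := Fact.mk (hp j)
    have h1 := congrArg (padicValRat (p j)) hprod
    have hne : (∏ j, p j ^ e j) ≠ 0 := prod_ne_zero_iff.mpr fun j _ => pow_ne_zero _ (hp j).ne_zero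
    have hr0 : r ≠ 0 := by
      rintro rfl
      rw [zero_pow hq.ne_zero] at hprod
      exact hne (by exact_mod_cast hprod)
    rw [padicValRat.of_nat, padicValRat.pow, ← Nat.factorization_def _ (hp j),
      fact_prod p hp hinj] at h1
    have h2 := congrArg (Int.cast : ℤ → ZMod q) h1
    push_cast at h2
    rw [h2]; simp
  have hvec : (∑ a : A, (c a : ZMod q) • u a) + (m : ZMod q) • w = 0 := by
    funext j
    have := hzero j
    simp only [e] at this
    push_cast at this
    simp only [ZMod.natCast_zmod_val] at this
    rw [Pi.add_apply, Finset.sum_apply, Pi.zero_apply, ← this]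
    simp [mul_comm]
  have h3 := congrArg φ hvec
  rw [map_add, map_sum, map_zero, map_smul, sum_eq_zero, zero_add, smul_eq_mul] at h3
  · rcases mul_eq_zero.mp h3 with h | h
    · exact absurd ((ZMod.natCast_eq_zero_iff _ _).mp h) hm
    · exact h
  · intro a _
    rw [map_smul, hu0, smul_zero]

end MV

end PartF

section PartG
open Finset

section Lift

lemma lift_pow {q : ℕ} (hq : q.Prime) (s : ℤ) (N : ℕ) (hN : 0 < N)
    (h : ∀ l : ℕ, l.Prime → l ∣ N → l ≠ q ∧ ¬ (l : ℤ) ∣ s ∧ ∃ x : ℤ, (l : ℤ) ∣ x ^ q - s) :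
    ∃ x : ℤ, (N : ℤ) ∣ x ^ q - s := by
  induction N using induction_on_primes with
  | zero => omega
  | one => exact ⟨0, by simp⟩
  | prime_mul l M hl ih =>
    obtain ⟨x, hx⟩ := ih (Nat.pos_of_mul_pos_left hN) (fun r hr hrM => h r hr (hrM.mul_left _))
    obtain ⟨hlq, hls, y, hy⟩ := h l hl (Dvd.intro _ rfl)
    have hlp : Prime (l : ℤ) := Nat.prime_iff_prime_int.mp hl
    by_cases hlM : l ∣ M
    · have hlM' : (l : ℤ) ∣ M := by exact_mod_cast hlM
      have hlx : ¬ (l : ℤ) ∣ x := by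
        intro hlx
        apply hls
        have h1 : (l : ℤ) ∣ x ^ q := hlx.trans (dvd_pow_self _ hq.ne_zero)
        have := dvd_sub h1 (hlM'.trans hx)
        simpa using this
      obtain ⟨c, hc⟩ := hx
      have hcop : IsCoprime (l : ℤ) (q * x ^ (q - 1)) := by
        rw [hlp.coprime_iff_not_dvd]
        intro hd
        rcases hlp.dvd_or_dvd hd with hd | hd
        · exact hlq ((Nat.prime_dvd_prime_iff_eq hl hq).mp (by exact_mod_cast hd))
        · exact hlx (hlp.dvd_of_dvd_pow hd)
      obtain ⟨u, v, huv⟩ := hcop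
      obtain ⟨t, ht⟩ := hlM'
      obtain ⟨k, hk⟩ := Polynomial.powAddExpansion x ((M : ℤ) * (-c * v)) q
      refine ⟨x + M * (-c * v), c * u + k * t * (c * v) ^ 2, ?_⟩
      rw [hk]
      push_cast
      have h2 : (v * (q * x ^ (q - 1)) : ℤ) = 1 - u * l := by linear_combination huv
      have h3 : x ^ q = M * c + s := by linear_combination hc
      rw [h3]
      linear_combination (-(M : ℤ) * c) * h2 + (k * (M : ℤ) * c ^ 2 * v ^ 2) * ht
    · have hcop : IsCoprime (l : ℤ) (M : ℤ) := by
        rw [hlp.coprime_iff_not_dvd]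
        exact_mod_cast hlM
      have hcop' := hcop
      obtain ⟨u, v, huv⟩ := hcop'
      refine ⟨y * (v * M) + x * (u * l), ?_⟩
      push_cast
      apply hcop.mul_dvd
      · have h1 : (l : ℤ) ∣ (y * (v * M) + x * (u * l)) - y :=
          ⟨u * (x - y), by linear_combination y * huv⟩
        have h2 := h1.trans (sub_dvd_pow_sub_pow _ _ q)
        have := dvd_add h2 hy
        simpa using this
      · have h1 : (M : ℤ) ∣ (y * (v * M) + x * (u * l)) - x :=
          ⟨v * (y - x), by linear_combination x * huv⟩
        have h2 := h1.trans (sub_dvd_pow_sub_pow _ _ q)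
        have := dvd_add h2 hx
        simpa using this

end Lift

section Codim

lemma exists_functional {q n : ℕ} (p : Fin n → ℕ) (hq : q.Prime) {l : ℕ} (hl : l.Prime)
    (hpl : ∀ j, ¬ l ∣ p j) :
    ∃ f : (Fin n → ZMod q) →ₗ[ZMod q] ZMod q, ∀ v, f v = 0 → IsRes q l (mv p v) := by
  have hF := Fact.mk hl
  have hFq := Fact.mk hq
  obtain ⟨g, hg⟩ := IsCyclic.exists_generator (α := (ZMod l)ˣ)
  have hex : ∀ j, ∃ e : ℕ, ((g : ZMod l)) ^ e = (p j : ZMod l) := by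
    intro j
    have h0 : (p j : ZMod l) ≠ 0 := by
      rw [Ne, ZMod.natCast_eq_zero_iff]; exact hpl j
    obtain ⟨e, he⟩ := (isOfFinOrder_of_finite g).mem_powers_iff_mem_zpowers.mpr (hg (Units.mk0 _ h0))
    refine ⟨e, ?_⟩
    have := congrArg Units.val he
    simpa using this
  choose e he using hex
  refine ⟨∑ j, (e j : ZMod q) • LinearMap.proj j, ?_⟩
  intro v hv
  have h1 : ((∑ j, e j * (v j).val : ℕ) : ZMod q) = 0 := by
    rw [← hv]
    simp [LinearMap.sum_apply]
  obtain ⟨t, ht⟩ := (ZMod.natCast_eq_zero_iff _ _).mp h1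
  refine ⟨(g : ZMod l) ^ t, ?_⟩
  rw [← pow_mul, mul_comm, ← ht, mv]
  push_cast
  rw [← prod_pow_eq_pow_sum]
  apply prod_congr rfl
  intro j _
  rw [pow_mul, he]

end Codim

section Decomp
variable {q : ℕ} {S : Finset ℤ}

/-- the enumeration of the primes -/
def pe (q : ℕ) (S : Finset ℤ) : Fin (qPrimes q S).card → ℕ :=
  fun i => ((qPrimes q S).orderIsoOfFin rfl i).1

lemma pe_mem (i) : pe q S i ∈ qPrimes q S := ((qPrimes q S).orderIsoOfFin rfl i).2

lemma mem_qPrimes {r : ℕ} : r ∈ qPrimes q S ↔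
    ∃ s ∈ S, r ∈ s.natAbs.primeFactors ∧ ¬ q ∣ s.natAbs.factorization r := by
  simp only [qPrimes, Finset.mem_sup, mem_filter]

lemma pe_prime (i) : (pe q S i).Prime := by
  obtain ⟨s, -, h, -⟩ := mem_qPrimes.mp (pe_mem (q := q) (S := S) i)
  exact Nat.prime_of_mem_primeFactors h

lemma pe_inj : Function.Injective (pe q S) := by
  intro i j h
  exact ((qPrimes q S).orderIsoOfFin rfl).injective (Subtype.ext h)

lemma pe_dvd (i) : ∃ s ∈ S, pe q S i ∣ s.natAbs := by
  obtain ⟨s, hs, h, -⟩ := mem_qPrimes.mp (pe_mem (q := q) (S := S) i)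
  exact ⟨s, hs, Nat.dvd_of_mem_primeFactors h⟩

lemma decomp (hodd : Odd q) {s : ℤ} (hs : s ∈ S) (hs0 : s ≠ 0) :
    ∃ t : ℤ, s = mv (pe q S) (vecOf q (qPrimes q S) s) * t ^ q := by
  have key : ∃ t : ℕ, s.natAbs = mv (pe q S) (vecOf q (qPrimes q S) s) * t ^ q := by
    have h0 : s.natAbs ≠ 0 := Int.natAbs_ne_zero.mpr hs0
    refine ⟨∏ r ∈ s.natAbs.primeFactors, r ^ (s.natAbs.factorization r / q), ?_⟩
    have h1 : mv (pe q S) (vecOf q (qPrimes q S) s) =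
        ∏ r ∈ qPrimes q S, r ^ (s.natAbs.factorization r % q) := by
      rw [← Finset.prod_coe_sort, mv]
      apply Fintype.prod_equiv ((qPrimes q S).orderIsoOfFin rfl).toEquiv
      intro i
      simp only [vecOf, ZMod.val_natCast]
      rfl
    have h2 : ∏ r ∈ qPrimes q S, r ^ (s.natAbs.factorization r % q) =
        ∏ r ∈ s.natAbs.primeFactors, r ^ (s.natAbs.factorization r % q) := by
      have h3 : ∀ r, r ∉ s.natAbs.primeFactors → s.natAbs.factorization r = 0 := by
        intro r hr
        rwa [← Nat.support_factorization, Finsupp.notMem_support_iff] at hr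
      refine (prod_subset (subset_union_left (s₂ := s.natAbs.primeFactors)) ?_).trans
        (prod_subset (subset_union_right (s₁ := qPrimes q S)) ?_).symm
      · intro r _ hr
        by_cases hr' : r ∈ s.natAbs.primeFactors
        · have : q ∣ s.natAbs.factorization r := by
            by_contra hc
            exact hr (mem_qPrimes.mpr ⟨s, hs, hr', hc⟩)
          rw [Nat.mod_eq_zero_of_dvd this, pow_zero]
        · rw [h3 r hr']; simp
      · intro r _ hr
        rw [h3 r hr]; simp
    rw [h1, h2, ← prod_pow, ← prod_mul_distrib]
    conv_lhs => rw [← Nat.prod_factorization_pow_eq_self h0]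
    rw [Finsupp.prod, Nat.support_factorization]
    apply prod_congr rfl
    intro r _
    rw [← pow_mul, ← pow_add]
    congr 1
    rw [mul_comm (_ / q)]
    exact (Nat.mod_add_div _ _).symm
  obtain ⟨t, ht⟩ := key
  rcases Int.natAbs_eq s with h | h
  · refine ⟨t, ?_⟩
    rw [ht] at h
    rw [← Nat.cast_pow, ← Nat.cast_mul]
    exact h
  · refine ⟨-t, ?_⟩
    rw [ht] at h
    rw [hodd.neg_pow, mul_neg, ← Nat.cast_pow, ← Nat.cast_mul]
    exact h

lemma vec_ne (hodd : Odd q) {s : ℤ} (hs : s ∈ S) (hs0 : s ≠ 0) (hp : ¬ IsPerfectPow q s) :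
    vecOf q (qPrimes q S) s ≠ 0 := by
  intro h
  obtain ⟨t, ht⟩ := decomp hodd hs hs0
  rw [h] at ht
  exact hp ⟨t, by rw [ht]; simp [mv]⟩

lemma res_iff (hq : q.Prime) (hodd : Odd q) {s : ℤ} (hs : s ∈ S) (hs0 : s ≠ 0) {l : ℕ}
    (hl : l.Prime) (hls : ¬ (l : ℤ) ∣ s) :
    (∃ x : ℤ, (l : ℤ) ∣ x ^ q - s) ↔ IsRes q l (mv (pe q S) (vecOf q (qPrimes q S) s)) := by
  have hF := Fact.mk hl
  obtain ⟨t, ht⟩ := decomp hodd hs hs0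
  have ht0 : (t : ZMod l) ≠ 0 := by
    rw [Ne, ZMod.intCast_zmod_eq_zero_iff_dvd]
    intro h
    apply hls
    rw [ht]
    exact Dvd.dvd.mul_left (h.trans (dvd_pow_self _ hq.ne_zero)) _
  have hs' : (s : ZMod l) = (mv (pe q S) (vecOf q (qPrimes q S) s) : ZMod l) * (t : ZMod l) ^ q := by
    have := congrArg (Int.cast : ℤ → ZMod l) ht
    push_cast at this
    exact this
  constructor
  · rintro ⟨x, hx⟩
    refine ⟨x / t, ?_⟩
    rw [← ZMod.intCast_zmod_eq_zero_iff_dvd] at hx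
    push_cast at hx
    rw [div_pow, sub_eq_zero.mp hx, hs', mul_div_cancel_right₀ _ (pow_ne_zero _ ht0)]
  · rintro ⟨y, hy⟩
    refine ⟨(y.val : ℤ) * t, ?_⟩
    rw [← ZMod.intCast_zmod_eq_zero_iff_dvd]
    push_cast
    rw [hs', ← hy, ZMod.natCast_zmod_val]
    ring

end Decomp

theorem dir_one (q k : ℕ) (hq : q.Prime) (hodd : Odd q)
    (S : Finset ℤ) (hS0 : ∀ s ∈ S, s ≠ 0) (hSpow : ∀ s ∈ S, ¬ IsPerfectPow q s)
    (hM : MemT q k ↑S) : IsBlockingSet q (qPrimes q S).card k (assocPoints q S) := by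
  have hFq := Fact.mk hq
  intro W hW
  by_contra! hcon
  have hnot : ∀ s ∈ S, vecOf q (qPrimes q S) s ∉ W := fun s hs h =>
    hcon _ h (vec_ne hodd hs (hS0 s hs) (hSpow s hs)) ⟨s, hs, rfl⟩
  obtain ⟨Δ, hΔ, hM⟩ := hM
  have hdim := Subspace.finrank_add_finrank_dualAnnihilator_eq W
  rw [hW, Module.finrank_fin_fun] at hdim
  let b := Module.finBasis (ZMod q) W.dualAnnihilator
  have hΔ' : 0 < Δ * ∏ s ∈ S, s.natAbs := Nat.mul_pos hΔ
    (prod_pos fun s hs => Int.natAbs_pos.mpr (hS0 s hs))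
  have hb : ∀ i, (b i).1 ≠ 0 := fun i h => b.ne_zero i (Subtype.ext h)
  choose l hl hlΔ hlp hlres using fun i =>
    exists_prime_nonres (pe q S) hq pe_prime pe_inj (b i).1 (hb i) hΔ'
  have hlen := (Nat.primeFactorsList_unique (l := List.ofFn l) rfl (by
    intro r hr
    obtain ⟨i, rfl⟩ := (List.mem_ofFn' _ _).mp hr
    exact hl i)).length_eq
  rw [List.length_ofFn] at hlen
  have hdvd : ∀ i, l i ∣ (List.ofFn l).prod := fun i =>
    List.dvd_prod ((List.mem_ofFn' _ _).mpr ⟨i, rfl⟩)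
  obtain ⟨s, hs, x, hx⟩ := hM (List.ofFn l).prod (by
    apply List.prod_pos
    intro r hr
    obtain ⟨i, rfl⟩ := (List.mem_ofFn' _ _).mp hr
    exact (hl i).pos) (by rw [← hlen]; omega) (by
    rw [Nat.coprime_list_prod_left_iff]
    intro r hr
    obtain ⟨i, rfl⟩ := (List.mem_ofFn' _ _).mp hr
    exact ((hl i).coprime_iff_not_dvd).mpr fun h => hlΔ i (h.mul_right _))
  have hs : s ∈ S := hs
  apply hnot s hs
  rw [← Subspace.forall_mem_dualAnnihilator_apply_eq_zero_iff]
  have hbi : ∀ i, (b i).1 (vecOf q (qPrimes q S) s) = 0 := by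
    intro i
    apply hlres i
    rw [← res_iff hq hodd hs (hS0 s hs) (hl i)]
    · exact ⟨x, (Int.natCast_dvd_natCast.mpr (hdvd i)).trans hx⟩
    · intro h
      exact hlΔ i (Dvd.dvd.mul_left ((Int.natCast_dvd.mp h).trans (dvd_prod_of_mem _ hs)) _)
  intro φ hφ
  have h1 := b.sum_repr ⟨φ, hφ⟩
  have h2 := congrArg (fun z : W.dualAnnihilator => z.1 (vecOf q (qPrimes q S) s)) h1
  simp only at h2
  rw [← h2, Submodule.coe_sum, LinearMap.sum_apply]
  apply sum_eq_zero
  intro i _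
  rw [Submodule.coe_smul, LinearMap.smul_apply, hbi, smul_zero]

theorem dir_two (q k : ℕ) (hq : q.Prime) (hodd : Odd q)
    (S : Finset ℤ) (hS0 : ∀ s ∈ S, s ≠ 0)
    (hB : IsBlockingSet q (qPrimes q S).card k (assocPoints q S)) : MemT q k ↑S := by
  have hFq := Fact.mk hq
  refine ⟨q * ∏ s ∈ S, s.natAbs, Nat.mul_pos hq.pos
    (prod_pos fun s hs => Int.natAbs_pos.mpr (hS0 s hs)), ?_⟩
  intro N hN hlen hcop
  have hnd : ∀ l : ℕ, l.Prime → l ∣ N → ¬ l ∣ q * ∏ s ∈ S, s.natAbs := by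
    intro l hl hlN h
    have := Nat.dvd_gcd hlN h
    rw [hcop] at this
    exact hl.one_lt.ne' (Nat.dvd_one.mp this)
  have hls : ∀ l : ℕ, l.Prime → l ∣ N → ∀ s ∈ S, ¬ l ∣ s.natAbs := by
    intro l hl hlN s hs h
    exact hnd l hl hlN (Dvd.dvd.mul_left (h.trans (dvd_prod_of_mem _ hs)) _)
  have hlp : ∀ l : ℕ, l.Prime → l ∣ N → ∀ j, ¬ l ∣ pe q S j := by
    intro l hl hlN j h
    obtain ⟨s, hs, h'⟩ := pe_dvd (q := q) (S := S) j
    exact hls l hl hlN s hs (h.trans h')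
  choose f hf using fun l : N.primeFactors => exists_functional (pe q S) hq
    (Nat.prime_of_mem_primeFactors l.2)
    (hlp l.1 (Nat.prime_of_mem_primeFactors l.2) (Nat.dvd_of_mem_primeFactors l.2))
  let F := LinearMap.pi f
  have h1 := LinearMap.finrank_range_add_finrank_ker F
  have h2 : Module.finrank (ZMod q) (LinearMap.range F) ≤ k := by
    refine (Submodule.finrank_le _).trans ?_
    rw [Module.finrank_fintype_fun_eq_card, Fintype.card_coe]
    exact (List.toFinset_card_le _).trans hlen
  rw [Module.finrank_fin_fun] at h1
  obtain ⟨w, hw⟩ := exists_linearIndependent_of_le_finrank (R := ZMod q)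
    (M := LinearMap.ker F) (n := (qPrimes q S).card - k) (by omega)
  have hw' : LinearIndependent (ZMod q) (fun i => (w i : Fin (qPrimes q S).card → ZMod q)) :=
    hw.map' (LinearMap.ker F).subtype (Submodule.ker_subtype _)
  let W := Submodule.span (ZMod q) (Set.range fun i => (w i : Fin (qPrimes q S).card → ZMod q))
  have hWF : W ≤ LinearMap.ker F := by
    rw [Submodule.span_le]
    rintro _ ⟨i, rfl⟩
    exact (w i).2
  obtain ⟨v, hv, -, s, hs, hvs⟩ := hB W (by
    rw [finrank_span_eq_card hw', Fintype.card_fin])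
  have hsW : vecOf q (qPrimes q S) s ∈ LinearMap.ker F := by
    apply hWF
    have h3 : vecOf q (qPrimes q S) s ∈ projPoint v := by
      rw [hvs]; exact Submodule.mem_span_singleton_self _
    obtain ⟨c, hc⟩ := Submodule.mem_span_singleton.mp h3
    rw [← hc]
    exact W.smul_mem c hv
  refine ⟨s, hs, lift_pow hq s N hN ?_⟩
  intro l hl hlN
  have hlm : l ∈ N.primeFactors := Nat.mem_primeFactors.mpr ⟨hl, hlN, hN.ne'⟩
  have hls' : ¬ (l : ℤ) ∣ s := fun h => hls l hl hlN s hs (Int.natCast_dvd.mp h)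
  refine ⟨?_, hls', ?_⟩
  · rintro rfl
    exact hnd _ hl hlN (Dvd.intro _ rfl)
  · rw [res_iff hq hodd hs (hS0 s hs) hl hls']
    apply hf ⟨l, hlm⟩
    exact congrFun (LinearMap.mem_ker.mp hsW) ⟨l, hlm⟩

end PartG

end QBlock

/-- **Theorem (main result).** Let `q` be an odd prime and `k ≥ 1`. A finite set `S` of nonzero
integers not containing any perfect `q`-th power belongs to `𝒯_{k,q}` iff the set of projective
points associated with `S` is a `k`-blocking set of `PG(F_q^n)`, where `n` is the number of
distinct primes dividing `∏_{s ∈ S} rad_q(|s|)`. -/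
theorem stmt0 (q k : ℕ) (hq : q.Prime) (hodd : Odd q) (hk : 1 ≤ k)
    (S : Finset ℤ) (hS0 : ∀ s ∈ S, s ≠ 0) (hSpow : ∀ s ∈ S, ¬ IsPerfectPow q s) :
    MemT q k ↑S ↔ IsBlockingSet q (qPrimes q S).card k (assocPoints q S) := by
  exact ⟨QBlock.dir_one q k hq hodd S hS0 hSpow, QBlock.dir_two q k hq hodd S hS0⟩
end

section
/- Let q be an odd prime, k ≥ 1 a natural number, and S a finite set of integers not containing any perfect q-th power. If S belongs to 𝒯_{k,q}, then the number of distinct primes p such that q does not divide v_p(|s|) for some s ∈ S (equivalently, the number of distinct primes dividing ∏_{s∈S} rad_q(|s|)) is at least k + 1. -/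
open Finset

/-- weights supported on good primes -/
noncomputable def goodW (q Δ : ℕ) (n : ℕ) : ℝ :=
  open Classical in if n.Prime ∧ (n : ZMod q) = 1 ∧ ¬ n ∣ Δ then q * Real.log n else 0

/-- real Dirichlet series -/
noncomputable def rD (f : ℕ → ℝ) (x : ℝ) : ℝ := ∑' n : ℕ, f n / (n : ℝ) ^ x

lemma term_real (f : ℕ → ℝ) {x : ℝ} (hx : x ≠ 0) (n : ℕ) :
    LSeries.term (fun n => (f n : ℂ)) x n = ((f n / (n : ℝ) ^ x : ℝ) : ℂ) := by
  rcases eq_or_ne n 0 with rfl | hn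
  · simp [Real.zero_rpow hx]
  · rw [LSeries.term_of_ne_zero hn]
    push_cast
    rw [Complex.ofReal_cpow (by positivity)]
    simp

lemma LSeries_real (f : ℕ → ℝ) {x : ℝ} (hx : x ≠ 0) :
    LSeries (fun n => (f n : ℂ)) x = (rD f x : ℂ) := by
  rw [LSeries, rD, Complex.ofReal_tsum]
  exact tsum_congr fun n => term_real f hx n

lemma summable_real (f : ℕ → ℝ) {x : ℝ} (hx : x ≠ 0) :
    LSeriesSummable (fun n => (f n : ℂ)) x ↔ Summable (fun n : ℕ => f n / (n : ℝ) ^ x) := by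
  rw [LSeriesSummable, ← Complex.summable_ofReal]
  exact summable_congr fun n => term_real f hx n

lemma goodW_nonneg (q Δ n : ℕ) : 0 ≤ goodW q Δ n := by
  unfold goodW; split_ifs <;> positivity

open ArithmeticFunction vonMangoldt in
lemma goodW_le (q Δ n : ℕ) : goodW q Δ n ≤ q * ArithmeticFunction.vonMangoldt n := by
  unfold goodW; split_ifs with h
  · rw [vonMangoldt_apply_prime h.1]
  · have := @vonMangoldt_nonneg n
    positivity

open ArithmeticFunction in
lemma goodW_summable (q Δ : ℕ) {x : ℝ} (hx : 1 < x) :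
    Summable (fun n : ℕ => goodW q Δ n / (n : ℝ) ^ x) := by
  have := LSeriesSummable_vonMangoldt (s := x) (by simpa)
  have h2 := (summable_real _ (by linarith)).1 this
  refine Summable.of_nonneg_of_le (fun n => ?_) (fun n => ?_) (h2.mul_left (q : ℝ))
  · have := goodW_nonneg q Δ n; positivity
  · rw [← mul_div_assoc]
    gcongr
    exact goodW_le q Δ n

open ArithmeticFunction vonMangoldt in
lemma goodW_lower (q Δ : ℕ) (hq : q.Prime) (hΔ : 0 < Δ) :
    ∃ C : ℝ, ∀ x : ℝ, 1 < x → x ≤ 2 →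
      (q / (q - 1) : ℝ) / (x - 1) - C ≤ rD (goodW q Δ) x := by
  have : NeZero q := ⟨hq.ne_zero⟩
  obtain ⟨C, hC⟩ := LSeries_residueClass_lower_bound (q := q) (a := 1) isUnit_one
  have hs := summable_residueClass_non_primes_div (q := q) 1
  set np : ℕ → ℝ := fun n => (if n.Prime then 0 else residueClass (1 : ZMod q) n) with hnp
  set sm : ℕ → ℝ := fun n => if n ∈ Δ.divisors then Real.log n else 0 with hsm
  have hsms : Summable (fun n : ℕ => sm n / n) := by
    apply summable_of_ne_finset_zero (s := Δ.divisors)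
    intro n hn
    simp only [hsm, if_neg hn, zero_div]
  refine ⟨q * (C + ∑' n : ℕ, np n / n + ∑' n : ℕ, sm n / n), fun x hx hx2 => ?_⟩
  have h1 := hC (x := x) ⟨hx, hx2⟩
  have hnp0 : ∀ n, 0 ≤ np n := fun n => by
    simp only [hnp]; split_ifs; · rfl
    exact residueClass_nonneg _ _
  have hsm0 : ∀ n, 0 ≤ sm n := fun n => by
    simp only [hsm]; split_ifs; · positivity
    · rfl
  have hle : ∀ (f : ℕ → ℝ), (∀ n, 0 ≤ f n) → ∀ n : ℕ, f n / (n : ℝ) ^ x ≤ f n / n := by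
    intro f hf n
    rcases eq_or_ne n 0 with rfl | hn
    · simp [Real.zero_rpow (by linarith : x ≠ 0)]
    · have : (1 : ℝ) ≤ n := by exact_mod_cast Nat.one_le_iff_ne_zero.2 hn
      have h2 : (n : ℝ) ≤ (n : ℝ) ^ x := by
        conv_lhs => rw [← Real.rpow_one (n : ℝ)]
        exact Real.rpow_le_rpow_of_exponent_le this hx.le
      have := hf n
      gcongr
  have key : ∀ n : ℕ, (q : ℝ) * (residueClass (1 : ZMod q) n / (n : ℝ) ^ x) ≤
      goodW q Δ n / (n : ℝ) ^ x + q * (np n / n) + q * (sm n / n) := by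
    intro n
    have hmain : q * residueClass (1 : ZMod q) n ≤ goodW q Δ n + q * np n + q * sm n := by
      have a1 := goodW_nonneg q Δ n
      have a2 : (0 : ℝ) ≤ q * np n := by have := hnp0 n; positivity
      have a3 : (0 : ℝ) ≤ q * sm n := by have := hsm0 n; positivity
      by_cases hp : n.Prime
      · by_cases h1 : (n : ZMod q) = 1
        · have hr : residueClass (1 : ZMod q) n = Real.log n := by
            rw [residueClass, Set.indicator_of_mem (by exact h1), vonMangoldt_apply_prime hp]
          rw [hr]
          by_cases hd : n ∣ Δ
          · have : sm n = Real.log n := by simp [hsm, hd, hΔ.ne']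
            rw [this] at a3 ⊢; linarith
          · have : goodW q Δ n = q * Real.log n := by simp [goodW, hp, h1, hd]
            linarith
        · have hr : residueClass (1 : ZMod q) n = 0 := by
            rw [residueClass, Set.indicator_of_notMem (by exact h1)]
          rw [hr, mul_zero]; linarith
      · have : np n = residueClass (1 : ZMod q) n := by simp [hnp, hp]
        rw [this] at a2 ⊢; linarith
    have e1 := hle np hnp0 n
    have e2 := hle sm hsm0 n
    have e3 : (q : ℝ) * (residueClass (1 : ZMod q) n / (n : ℝ) ^ x) ≤
      goodW q Δ n / (n : ℝ) ^ x + q * (np n / (n : ℝ) ^ x) + q * (sm n / (n : ℝ) ^ x) := by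
      rw [← mul_div_assoc, ← mul_div_assoc, ← mul_div_assoc, ← add_div, ← add_div]
      gcongr
    have hq0 : (0 : ℝ) ≤ q := by positivity
    nlinarith [mul_le_mul_of_nonneg_left e1 hq0, mul_le_mul_of_nonneg_left e2 hq0]
  have hS1 : Summable (fun n : ℕ => residueClass (1 : ZMod q) n / (n : ℝ) ^ x) := by
    have := (summable_real _ (by linarith)).1
      (LSeriesSummable_vonMangoldt (s := x) (by simpa))
    refine Summable.of_nonneg_of_le (fun n => ?_) (fun n => ?_) this
    · have := residueClass_nonneg (1 : ZMod q) n; positivity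
    · gcongr; exact residueClass_le _ _
  have hG := goodW_summable q Δ hx
  have h3 := ((hS1.mul_left (q : ℝ))).tsum_le_tsum key
    ((hG.add (hs.mul_left (q:ℝ))).add (hsms.mul_left (q:ℝ)))
  rw [(hG.add (hs.mul_left (q:ℝ))).tsum_add (hsms.mul_left (q:ℝ)), hG.tsum_add (hs.mul_left (q:ℝ)),
    tsum_mul_left, tsum_mul_left, tsum_mul_left] at h3
  rw [Nat.totient_prime hq, Nat.cast_sub hq.one_le] at h1
  have hq0 : (0 : ℝ) ≤ q := by positivity
  have h4 := mul_le_mul_of_nonneg_left h1 hq0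
  change _ ≤ rD (goodW q Δ) x + _ + _ at h3
  have : (q / (q - 1) : ℝ) / (x - 1) = q * (((q : ℝ) - (1 : ℕ))⁻¹ / (x - 1)) := by
    push_cast; ring
  rw [this]
  linarith

open Filter Topology in
lemma analytic_contra (q Δ : ℕ) (hq : q.Prime) (hΔ : 0 < Δ) (a : ℕ → ℝ) (ha : ∀ n, 0 ≤ a n)
    (ha1 : 0 < a 1) (hs : ∀ x : ℝ, 1 < x → LSeriesSummable (fun n => (a n : ℂ)) x)
    (κ : ℝ) (hκ : 0 < κ) (hlim : Tendsto (fun s : ℝ => (s - 1) * rD a s) (𝓝[>] 1) (𝓝 κ))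
    (hconv : ∀ n : ℕ, n ≠ 0 →
      ∑ p ∈ n.divisorsAntidiagonal, goodW q Δ p.1 * a p.2 ≤ Real.log n * a n) : False := by
  obtain ⟨C, hC⟩ := goodW_lower q Δ hq hΔ
  have habs : LSeries.abscissaOfAbsConv (fun n => (a n : ℂ)) ≤ 1 :=
    LSeries.abscissaOfAbsConv_le_of_forall_lt_LSeriesSummable fun y hy => hs y (by exact_mod_cast hy)
  have hpos : ∀ x : ℝ, 1 < x → 0 < rD a x := by
    intro x hx
    have := (summable_real a (by linarith : x ≠ 0)).1 (hs x hx)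
    refine this.tsum_pos (fun n => by have := ha n; positivity) 1 (by simpa using ha1)
  have hder : ∀ x : ℝ, 1 < x → HasDerivAt (rD a) (- rD (fun n => Real.log n * a n) x) x := by
    intro x hx
    have h1 := LSeries_hasDerivAt (s := (x : ℂ)) (f := fun n => (a n : ℂ))
      (lt_of_le_of_lt habs (by simpa using (by exact_mod_cast hx)))
    have h2 := h1.real_of_complex
    have h3 : LSeries (LSeries.logMul fun n => (a n : ℂ)) x
        = (rD (fun n => Real.log n * a n) x : ℂ) := by
      rw [← LSeries_real _ (by linarith : x ≠ 0)]
      congr 1; ext n; simp [LSeries.logMul, Complex.natCast_log]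
    rw [h3] at h2
    have h4 : (-(rD (fun n => Real.log n * a n) x : ℂ)).re = - rD (fun n => Real.log n * a n) x := by
      simp
    rw [h4] at h2
    refine h2.congr_of_eventuallyEq ?_
    filter_upwards [lt_mem_nhds hx] with y hy
    rw [LSeries_real a (by linarith : y ≠ 0)]; simp
  have hineq : ∀ x : ℝ, 1 < x → rD (goodW q Δ) x * rD a x ≤ rD (fun n => Real.log n * a n) x := by
    intro x hx
    have hx0 : x ≠ 0 := by linarith
    have hw := (summable_real _ hx0).2 (goodW_summable q Δ hx)
    have hc := LSeries_convolution' hw (hs x hx)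
    have hcs := hw.convolution (hs x hx)
    have hcf : LSeries.convolution (fun n => (goodW q Δ n : ℂ)) (fun n => (a n : ℂ)) =
        fun n => ((∑ p ∈ n.divisorsAntidiagonal, goodW q Δ p.1 * a p.2 : ℝ) : ℂ) := by
      rw [LSeries.convolution_def]; ext n; push_cast; rfl
    rw [hcf] at hc hcs
    rw [LSeries_real _ hx0, LSeries_real _ hx0, LSeries_real _ hx0] at hc
    have hc' : rD (fun n => ∑ p ∈ n.divisorsAntidiagonal, goodW q Δ p.1 * a p.2) x =
        rD (goodW q Δ) x * rD a x := by exact_mod_cast hc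
    rw [← hc']
    have hl := LSeriesSummable_logMul_of_lt_re (s := (x : ℂ)) (f := fun n => (a n : ℂ))
      (lt_of_le_of_lt habs (by simpa using (by exact_mod_cast hx)))
    have hl2 : LSeriesSummable (fun n => ((Real.log n * a n : ℝ) : ℂ)) x := by
      convert hl using 1; ext n; simp [LSeries.logMul, Complex.natCast_log]
    refine ((summable_real _ hx0).1 hcs).tsum_le_tsum (fun n => ?_) ((summable_real _ hx0).1 hl2)
    rcases eq_or_ne n 0 with rfl | hn
    · simp
    · have := hconv n hn
      gcongr
  set c : ℝ := q / (q - 1) with hc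
  have hq1 : (1 : ℝ) < q := by exact_mod_cast hq.one_lt
  have hc1 : 1 < c := by rw [hc, lt_div_iff₀ (by linarith)]; linarith
  set h : ℝ → ℝ := fun s => Real.log (rD a s) + c * Real.log (s - 1) - C * s with hh
  have hhd : ∀ x : ℝ, 1 < x → HasDerivAt h
      ((- rD (fun n => Real.log n * a n) x) / rD a x + c * (1 / (x - 1)) - C * 1) x := by
    intro x hx
    have d1 := (hder x hx).log (hpos x hx).ne'
    have d2 : HasDerivAt (fun s : ℝ => Real.log (s - 1)) (1 / (x - 1)) x :=
      ((hasDerivAt_id x).sub_const 1).log (by simp; linarith)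
    exact (d1.add (d2.const_mul c)).sub ((hasDerivAt_id x).const_mul C)
  have hanti : AntitoneOn h (Set.Ioc 1 2) := by
    apply antitoneOn_of_deriv_nonpos (convex_Ioc 1 2)
    · intro x hx; exact (hhd x hx.1).continuousAt.continuousWithinAt
    · intro x hx; rw [interior_Ioc] at hx
      exact (hhd x hx.1).differentiableAt.differentiableWithinAt
    · intro x hx; rw [interior_Ioc] at hx
      rw [(hhd x hx.1).deriv]
      have i1 := hineq x hx.1
      have i2 := hC x hx.1 hx.2.le
      have i3 : (c / (x - 1) - C) ≤ rD (fun n => Real.log n * a n) x / rD a x := by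
        rw [le_div_iff₀ (hpos x hx.1)]
        exact (mul_le_mul_of_nonneg_right i2 (hpos x hx.1).le).trans i1
      rw [neg_div]
      have : c * (1 / (x - 1)) = c / (x - 1) := by ring
      linarith
  have hT1 : Tendsto (fun s : ℝ => Real.log ((s - 1) * rD a s)) (𝓝[>] 1) (𝓝 (Real.log κ)) :=
    hlim.log hκ.ne'
  have hsub : Tendsto (fun s : ℝ => s - 1) (𝓝[>] 1) (𝓝[>] 0) := by
    apply tendsto_nhdsWithin_iff.2
    constructor
    · have : Tendsto (fun s : ℝ => s - 1) (𝓝 1) (𝓝 (1 - 1)) := (continuous_id.sub continuous_const).tendsto 1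
      rw [sub_self] at this
      exact this.mono_left nhdsWithin_le_nhds
    · filter_upwards [self_mem_nhdsWithin] with s hs
      simpa using hs
  have hT2 : Tendsto (fun s : ℝ => (1 - c) * Real.log (s - 1) + (h 2 - |C| * 2)) (𝓝[>] 1) atTop := by
    apply tendsto_atTop_add_const_right
    exact (Real.tendsto_log_nhdsGT_zero.comp hsub).const_mul_atBot_of_neg (by linarith)
  have hT3 := tendsto_atTop_mono' (𝓝[>] (1 : ℝ)) (f₂ := fun s : ℝ => Real.log ((s - 1) * rD a s)) ?_ hT2
  · exact not_tendsto_nhds_of_tendsto_atTop hT3 _ hT1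
  · filter_upwards [Ioc_mem_nhdsGT (by norm_num : (1 : ℝ) < 2)] with s hs
    have := hanti hs (Set.right_mem_Ioc.2 (by norm_num)) hs.2
    have e : h s = Real.log (rD a s) + c * Real.log (s - 1) - C * s := rfl
    rw [Real.log_mul (by linarith [hs.1]) (hpos s hs.1).ne']
    have : - (|C| * 2) ≤ C * s := by
      have := neg_abs_le C
      nlinarith [abs_nonneg C, hs.1, hs.2]
    linarith

open Polynomial NumberField Ideal RingOfIntegers in
lemma card_norm_prime {F : Type} [Field F] [NumberField F] (θ : 𝓞 F) (q : ℕ) (hq : q.Prime) (a : ℤ)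
    (hmin : minpoly ℤ θ = X ^ q - C a) (l : ℕ) (hl : l.Prime) (hexp : ¬ l ∣ exponent θ)
    (hlq : (l : ZMod q) = 1) (hla : (a : ZMod l) ≠ 0) (hx : ∃ x : ZMod l, x ^ q = a) :
    q ≤ Nat.card {I : Ideal (𝓞 F) // absNorm I = l} := by
  obtain ⟨x, hx⟩ := hx
  have : Fact l.Prime := ⟨hl⟩
  have : Fact q.Prime := ⟨hq⟩
  have hx0 : x ≠ 0 := by
    rintro rfl
    rw [zero_pow hq.ne_zero] at hx
    exact hla hx.symm
  have hdvd : q ∣ Fintype.card (ZMod l)ˣ := by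
    rw [ZMod.card_units l]
    have h1 : ((l - 1 : ℕ) : ZMod q) = 0 := by
      rw [Nat.cast_sub hl.one_le, hlq]; simp
    exact (ZMod.natCast_eq_zero_iff _ _).1 h1
  obtain ⟨z, hz⟩ := exists_prime_orderOf_dvd_card q hdvd
  have hzq : ((z : ZMod l)) ^ q = 1 := by
    rw [← Units.val_pow_eq_pow_val, ← hz, pow_orderOf_eq_one]; rfl
  have hmem : ∀ i : Fin q, (X - C (x * (z : ZMod l) ^ (i : ℕ))) ∈ monicFactorsMod θ l := by
    intro i
    rw [monicFactorsMod, Multiset.mem_toFinset, Polynomial.mem_normalizedFactors_iff]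
    · refine ⟨irreducible_X_sub_C _, monic_X_sub_C _, ?_⟩
      rw [dvd_iff_isRoot, hmin]
      simp only [IsRoot.def, Polynomial.map_sub, Polynomial.map_pow, map_X, map_C, eval_sub, eval_pow, eval_X,
        eval_C, mul_pow]
      rw [hx, ← pow_mul, mul_comm (i : ℕ), pow_mul, hzq]
      simp
    · exact map_monic_ne_zero (minpoly.monic θ.isIntegral)
  let e := NumberField.Ideal.primesOverSpanEquivMonicFactorsMod hexp
  have hnorm : ∀ i : Fin q, absNorm ((e.symm ⟨_, hmem i⟩ : Ideal (𝓞 F))) = l := by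
    intro i
    have h1 := NumberField.Ideal.inertiaDeg_primesOverSpanEquivMonicFactorsMod_symm_apply' hexp (hmem i)
    have hp := (e.symm ⟨_, hmem i⟩).2
    have := hp.1
    have := hp.2
    have h2 := absNorm_eq_pow_inertiaDeg' ((e.symm ⟨_, hmem i⟩ : Ideal (𝓞 F))) hl
    rw [h2]
    have : (e.symm ⟨_, hmem i⟩ : Ideal (𝓞 F)).IsMaximal := Ideal.primesOver.isMaximal _
    have := Int.ideal_span_isMaximal_of_prime l
    rw [inertiaDeg'_eq_inertiaDeg]
    rw [show Ideal.inertiaDeg ((e.symm ⟨_, hmem i⟩ : Ideal (𝓞 F))) ℤ = 1 from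
      h1.trans (natDegree_X_sub_C _), pow_one]
  have hfin : Finite {I : Ideal (𝓞 F) // absNorm I = l} := finite_setOfPred_absNorm_eq l
  rw [← Nat.card_fin q]
  refine (Nat.card_fin q).le.trans (le_trans (Nat.card_fin q).ge ?_)
  apply Nat.card_le_card_of_injective (fun i : Fin q => (⟨_, hnorm i⟩ : {I : Ideal (𝓞 F) // absNorm I = l}))
  intro i j hij
  have h1 : e.symm ⟨_, hmem i⟩ = e.symm ⟨_, hmem j⟩ := Subtype.ext (by simpa using hij)
  have h2 := congrArg Subtype.val (e.symm.injective h1)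
  have h3 : x * (z : ZMod l) ^ (i : ℕ) = x * (z : ZMod l) ^ (j : ℕ) := by
    have := congrArg (eval 0) h2
    simpa using this
  have h4 : z ^ (i : ℕ) = z ^ (j : ℕ) := by
    apply Units.ext
    simpa using mul_left_cancel₀ hx0 h3
  apply Fin.ext
  exact pow_injOn_Iio_orderOf (by simp [hz]) (by simp [hz]) h4

open Polynomial NumberField Ideal RingOfIntegers in
lemma exponent_ne_zero' {F : Type} [Field F] [NumberField F] (θ : 𝓞 F)
    (h : Algebra.adjoin ℚ {(θ : F)} = ⊤) : exponent θ ≠ 0 := by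
  let B := PowerBasis.ofAdjoinEqTop (θ.isIntegral_coe.tower_top : IsIntegral ℚ (θ : F)) h
  have hB : B.gen = θ := by simp [B]
  have hIntegral : IsIntegral ℤ B.gen := hB ▸ θ.isIntegral_coe
  obtain ⟨D, hD⟩ := IsIntegrallyClosed.isIntegral_iff.1
    (Algebra.discr_isIntegral ℚ (R := ℤ) (b := B.basis) (fun i => by
      rw [B.basis_eq_pow]; exact hIntegral.pow _))
  have hD0 : D ≠ 0 := by
    rintro rfl
    exact Algebra.discr_not_zero_of_basis ℚ B.basis (by rw [← hD]; simp)
  have hmem : (D : 𝓞 F) ∈ conductor ℤ θ := by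
    rw [mem_conductor_iff]
    intro b
    have h1 := Algebra.discr_mul_isIntegral_mem_adjoin ℚ (R := ℤ) (B := B) hIntegral b.isIntegral_coe
    rw [← hD, hB] at h1
    obtain ⟨P, hP⟩ := Algebra.adjoin_mem_exists_aeval ℤ _ h1
    have : (D : 𝓞 F) * b = aeval θ P := by
      apply RingOfIntegers.coe_injective
      rw [map_mul]
      rw [← aeval_algebraMap_apply, hP]
      simp [Algebra.smul_def]
    rw [this]
    exact aeval_mem_adjoin_singleton ℤ θ
  rw [exponent, Ne, absNorm_eq_zero_iff]
  intro hbot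
  have : D ∈ under ℤ (conductor ℤ θ) := by
    rw [under_def, mem_comap]; simpa using hmem
  rw [hbot] at this
  exact hD0 (by simpa using this)

open Polynomial NumberField Ideal RingOfIntegers in
lemma exists_field (q : ℕ) (hq : q.Prime) (a : ℤ) (ha : ¬ ∃ r : ℤ, r ^ q = a) :
    ∃ (F : Type) (_ : Field F) (_ : NumberField F) (θ : 𝓞 F), minpoly ℤ θ = X ^ q - C a ∧
      exponent θ ≠ 0 := by
  have hirr : Irreducible (X ^ q - C (a : ℚ)) := by
    apply X_pow_sub_C_irreducible_of_prime hq
    intro b hb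
    have hbi : IsIntegral ℤ b := by
      refine ⟨X ^ q - C a, monic_X_pow_sub_C a hq.ne_zero, ?_⟩
      rw [eval₂_sub, eval₂_pow, eval₂_X, eval₂_C, hb]; simp
    obtain ⟨r, rfl⟩ := IsIntegrallyClosed.isIntegral_iff.1 hbi
    exact ha ⟨r, by
      have : ((r ^ q : ℤ) : ℚ) = a := by push_cast; simpa using hb
      exact_mod_cast this⟩
  have : Fact (Irreducible (X ^ q - C (a : ℚ))) := ⟨hirr⟩
  have hne : (X ^ q - C (a : ℚ)) ≠ 0 := hirr.ne_zero
  let F := AdjoinRoot (X ^ q - C (a : ℚ))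
  have hcz : CharZero F := charZero_of_injective_algebraMap (algebraMap ℚ F).injective
  have hfd : FiniteDimensional ℚ F := (AdjoinRoot.powerBasis hne).finite
  have hnf : NumberField F := { to_charZero := hcz, to_finiteDimensional := by convert hfd }
  let ρ : F := AdjoinRoot.root _
  have hρ : ρ ^ q = (a : F) := by
    have := AdjoinRoot.eval₂_root (X ^ q - C (a : ℚ))
    rw [eval₂_sub, eval₂_pow, eval₂_X, eval₂_C, sub_eq_zero] at this
    rw [this]; simp
  have hIntegral : IsIntegral ℤ ρ := by
    refine ⟨X ^ q - C a, monic_X_pow_sub_C a hq.ne_zero, ?_⟩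
    rw [eval₂_sub, eval₂_pow, eval₂_X, eval₂_C, hρ]; simp
  let θ : 𝓞 F := ⟨ρ, hIntegral⟩
  refine ⟨F, inferInstance, hnf, θ, ?_, ?_⟩
  · have h1 : minpoly ℤ θ = minpoly ℤ ρ :=
      (minpoly.algebraMap_eq (RingOfIntegers.coe_injective) θ).symm
    rw [h1]
    have h2 := minpoly.isIntegrallyClosed_eq_field_fractions' ℚ hIntegral
    have h3 : X ^ q - C (a : ℚ) = minpoly ℚ ρ := by
      apply minpoly.eq_of_irreducible_of_monic hirr _ (monic_X_pow_sub_C (a : ℚ) hq.ne_zero)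
      rw [map_sub, map_pow, aeval_X, aeval_C, hρ]; simp
    apply map_injective (algebraMap ℤ ℚ) (by exact (algebraMap ℤ ℚ).injective_int)
    refine h2.symm.trans (h3.symm.trans ?_)
    simp
  · apply exponent_ne_zero'
    exact AdjoinRoot.adjoinRoot_eq_top
open NumberField Ideal in
lemma coeff_ineq {F : Type} [Field F] [NumberField F] (q Δ : ℕ)
    (H : ∀ l : ℕ, l.Prime → (l : ZMod q) = 1 → ¬ l ∣ Δ →
      q ≤ Nat.card {I : Ideal (𝓞 F) // absNorm I = l}) (n : ℕ) (hn : n ≠ 0) :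
    ∑ p ∈ n.divisorsAntidiagonal,
      goodW q Δ p.1 * (Nat.card {I : Ideal (𝓞 F) // absNorm I = p.2} : ℝ) ≤
      Real.log n * (Nat.card {I : Ideal (𝓞 F) // absNorm I = n} : ℝ) := by
  classical
  let A : ℕ → Finset (Ideal (𝓞 F)) := fun m => (finite_setOfPred_absNorm_eq (S := 𝓞 F) m).toFinset
  have hA : ∀ m I, I ∈ A m ↔ absNorm I = m := fun m I => by simp [A]
  have hcard : ∀ m, Nat.card {I : Ideal (𝓞 F) // absNorm I = m} = (A m).card := fun m => by
    rw [← Set.ncard_eq_toFinset_card _ (finite_setOfPred_absNorm_eq (S := 𝓞 F) m)]; rfl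
  simp only [hcard] at H ⊢
  let P := n.divisors.filter (fun l => l.Prime)
  have s1 : ∑ p ∈ n.divisorsAntidiagonal, goodW q Δ p.1 * ((A p.2).card : ℝ) ≤
      ∑ l ∈ P, ∑ p ∈ A l, Real.log l * ((A (n / l)).card : ℝ) := by
    rw [Nat.sum_divisorsAntidiagonal (f := fun d e => goodW q Δ d * ((A e).card : ℝ))]
    rw [Finset.sum_filter]
    apply Finset.sum_le_sum
    intro l hl
    unfold goodW
    split_ifs with h1 h2 h2
    · rw [Finset.sum_const, nsmul_eq_mul, ← mul_assoc]
      have : (q : ℝ) ≤ (A l).card := by exact_mod_cast H l h1.1 h1.2.1 h1.2.2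
      have h0 : 0 ≤ Real.log l := Real.log_natCast_nonneg l
      gcongr
    · exact absurd h1.1 h2
    · rw [zero_mul]
      apply Finset.sum_nonneg
      intro i _
      have h0 : 0 ≤ Real.log l := Real.log_natCast_nonneg l
      positivity
    · simp
  refine s1.trans ?_
  have s2 : ∀ l ∈ P, ∀ p ∈ A l, Real.log l * ((A (n / l)).card : ℝ) ≤
      ∑ I ∈ A n, if p ∣ I then Real.log l else 0 := by
    intro l hl p hp
    rw [← Finset.sum_filter, Finset.sum_const, nsmul_eq_mul, mul_comm]
    have h0 : 0 ≤ Real.log l := Real.log_natCast_nonneg l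
    simp only [P, Finset.mem_filter, Nat.mem_divisors] at hl
    rw [hA] at hp
    have hp0 : p ≠ ⊥ := by
      rintro rfl
      rw [absNorm_bot] at hp
      exact hl.2.ne_zero hp.symm
    refine mul_le_mul_of_nonneg_right (Nat.cast_le.2 ?_) h0
    apply Finset.card_le_card_of_injOn (fun J => p * J)
    · intro J hJ
      simp only [Finset.mem_coe, hA] at hJ
      simp only [Finset.coe_filter, Set.mem_ofPred_eq, hA, map_mul, hp, hJ]
      exact ⟨Nat.mul_div_cancel' hl.1.1, dvd_mul_right _ _⟩
    · intro J _ J' _ h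
      exact mul_left_cancel₀ hp0 h
  refine (Finset.sum_le_sum fun l hl => Finset.sum_le_sum fun p hp => s2 l hl p hp).trans ?_
  have s3 : ∑ l ∈ P, ∑ p ∈ A l, ∑ I ∈ A n, (if p ∣ I then Real.log l else 0) =
      ∑ I ∈ A n, ∑ l ∈ P, ∑ p ∈ A l, (if p ∣ I then Real.log l else 0) := by
    rw [Finset.sum_comm (s := A n)]
    exact Finset.sum_congr rfl fun l _ => Finset.sum_comm
  rw [s3, mul_comm, ← nsmul_eq_mul, ← Finset.sum_const]
  apply Finset.sum_le_sum
  intro I hI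
  rw [hA] at hI
  have hI0 : I ≠ ⊥ := by
    rintro rfl
    rw [absNorm_bot] at hI
    exact hn hI.symm
  let Q := (P.biUnion A).filter (fun p => p ∣ I)
  have s4 : ∑ l ∈ P, ∑ p ∈ A l, (if p ∣ I then Real.log l else 0) =
      ∑ p ∈ Q, Real.log (absNorm p) := by
    rw [show Q = (P.biUnion A).filter (fun p => p ∣ I) from rfl, Finset.sum_filter (s := P.biUnion A),
      Finset.sum_biUnion]
    · refine Finset.sum_congr rfl fun l _ => Finset.sum_congr rfl fun p hp => ?_
      rw [(hA _ _).1 hp]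
    · intro l _ l' _ hne
      rw [Function.onFun, Finset.disjoint_left]
      intro p hp hp'
      exact hne (((hA _ _).1 hp).symm.trans ((hA _ _).1 hp'))
  have hQ : ∀ p ∈ Q, (absNorm p).Prime ∧ p ∣ I := by
    intro p hp
    simp only [Q, P, Finset.mem_filter, Finset.mem_biUnion, hA] at hp
    obtain ⟨⟨l, hl, hpl⟩, hd⟩ := hp
    exact ⟨hpl ▸ hl.2, hd⟩
  rw [s4, ← Real.log_prod (fun p hp => by exact_mod_cast (hQ p hp).1.ne_zero)]
  have hdvd : ∏ p ∈ Q, p ∣ I := by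
    apply Finset.prod_primes_dvd
    · intro p hp
      have h1 : p.IsPrime := Ideal.isPrime_of_irreducible_absNorm ((hQ p hp).1)
      refine Ideal.prime_of_isPrime ?_ h1
      rintro rfl
      have := (hQ _ hp).1
      simp at this
      exact Nat.not_prime_zero this
    · intro p hp; exact (hQ p hp).2
  have hdvd2 : ∏ p ∈ Q, absNorm p ∣ n := by
    rw [← map_prod, ← hI]; exact map_dvd absNorm hdvd
  apply Real.log_le_log
  · apply Finset.prod_pos
    intro p hp; exact_mod_cast (hQ p hp).1.pos
  · exact_mod_cast Nat.le_of_dvd (Nat.pos_of_ne_zero hn) hdvd2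

open NumberField Ideal RingOfIntegers Filter Topology in
lemma exists_nonresidue (q : ℕ) (hq : q.Prime) (a : ℤ) (ha : ¬ ∃ r : ℤ, r ^ q = a) (Δ : ℕ)
    (hΔ : 0 < Δ) : ∃ l : ℕ, l.Prime ∧ ¬ l ∣ Δ ∧ ¬ ∃ x : ZMod l, x ^ q = (a : ZMod l) := by
  by_contra! hcon
  have ha0 : a ≠ 0 := by
    rintro rfl
    exact ha ⟨0, zero_pow hq.ne_zero⟩
  obtain ⟨F, _, _, θ, hmin, hexp⟩ := exists_field q hq a ha
  let Δ' := Δ * exponent θ * a.natAbs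
  have hΔ' : 0 < Δ' := Nat.pos_of_ne_zero
    (mul_ne_zero (mul_ne_zero hΔ.ne' hexp) (Int.natAbs_ne_zero.2 ha0))
  have H : ∀ l : ℕ, l.Prime → (l : ZMod q) = 1 → ¬ l ∣ Δ' →
      q ≤ Nat.card {I : Ideal (𝓞 F) // absNorm I = l} := by
    intro l hl hlq hlΔ
    refine card_norm_prime θ q hq a hmin l hl ?_ hlq ?_ ?_
    · intro h; exact hlΔ ((h.mul_left _).mul_right _)
    · intro h
      rw [ZMod.intCast_zmod_eq_zero_iff_dvd] at h
      exact hlΔ ((Int.natCast_dvd.1 h).mul_left _)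
    · exact hcon l hl (fun h => hlΔ ((h.mul_right _).mul_right _))
  let c : ℕ → ℝ := fun n => (Nat.card {I : Ideal (𝓞 F) // absNorm I = n} : ℝ)
  have hz : ∀ x : ℝ, dedekindZeta F x = LSeries (fun n => (c n : ℂ)) x := by
    intro x; simp [dedekindZeta, c]
  have hlim := tendsto_sub_one_mul_dedekindZeta_nhdsGT F
  have hlim2 : Tendsto (fun s : ℝ => (s - 1) * rD c s) (𝓝[>] 1) (𝓝 (dedekindZeta_residue F)) := by
    have h1 : Tendsto (fun s : ℝ => (((s : ℂ) - 1) * dedekindZeta F s).re) (𝓝[>] 1)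
      (𝓝 (dedekindZeta_residue F)) := (Complex.continuous_re.tendsto _).comp hlim
    refine h1.congr' ?_
    filter_upwards [self_mem_nhdsWithin] with s hs
    have hs' : (1 : ℝ) < s := hs
    rw [hz, LSeries_real c (by linarith : s ≠ 0)]
    rw [← Complex.ofReal_one, ← Complex.ofReal_sub, ← Complex.ofReal_mul, Complex.ofReal_re]
  refine analytic_contra q Δ' hq hΔ' c (fun n => Nat.cast_nonneg _) ?_ ?_ _
    (dedekindZeta_residue_pos F) hlim2 (fun n hn => coeff_ineq q Δ' H n hn)
  · simp only [c, Nat.cast_pos]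
    have : Finite {I : Ideal (𝓞 F) // absNorm I = 1} := finite_setOfPred_absNorm_eq 1
    have : Nonempty {I : Ideal (𝓞 F) // absNorm I = 1} := ⟨⟨⊤, by simp⟩⟩
    exact Nat.card_pos
  · intro x hx
    by_contra hns
    have h0 : ∀ᶠ s : ℝ in 𝓝[>] 1, (s - 1) * rD c s = 0 := by
      filter_upwards [Ioc_mem_nhdsGT hx] with s hs
      have : ¬ LSeriesSummable (fun n => (c n : ℂ)) s := fun h =>
        hns (h.of_re_le_re (by simpa using hs.2))
      rw [summable_real c (by linarith [hs.1] : s ≠ 0)] at this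
      rw [rD, tsum_eq_zero_of_not_summable this, mul_zero]
    have := tendsto_nhds_unique (hlim2.congr' h0) tendsto_const_nhds
    exact dedekindZeta_residue_ne_zero F this

lemma exists_kernel_aux (q : ℕ) {ι M : Type} [Fintype ι] [AddCommGroup M]
    (hM : ∀ x : M, q • x = 0) (u : ι → M) :
    ∃ K : Submodule (ZMod q) (ι → ZMod q), ∀ m : ι → ℕ,
      (fun i => (m i : ZMod q)) ∈ K ↔ ∑ i, m i • u i = 0 := by
  let inst : Module (ZMod q) M := AddCommGroup.zmodModule hM
  refine ⟨LinearMap.ker (Fintype.linearCombination (ZMod q) u), fun m => ?_⟩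
  rw [LinearMap.mem_ker, Fintype.linearCombination_apply]
  simp only [Nat.cast_smul_eq_nsmul]

lemma exists_kernel (q : ℕ) (P : Finset ℕ) (l : ℕ) (hl : l.Prime)
    (hlP : ∀ p ∈ P, ¬ l ∣ p) :
    ∃ K : Submodule (ZMod q) (P → ZMod q), ∀ m : P → ℕ,
      (fun p => (m p : ZMod q)) ∈ K ↔ ∃ x : ZMod l, x ^ q = ∏ p : P, ((p : ℕ) : ZMod l) ^ m p := by
  have : Fact l.Prime := ⟨hl⟩
  let R : Subgroup (ZMod l)ˣ := (powMonoidHom q : (ZMod l)ˣ →* (ZMod l)ˣ).range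
  have hR : ∀ x : Additive ((ZMod l)ˣ ⧸ R), q • x = 0 := by
    intro x
    obtain ⟨y, rfl⟩ := Additive.ofMul.surjective x
    obtain ⟨g, rfl⟩ := QuotientGroup.mk_surjective y
    rw [← ofMul_pow, ← QuotientGroup.mk_pow, ofMul_eq_zero, QuotientGroup.eq_one_iff]
    exact ⟨g, rfl⟩
  have hu : ∀ p : P, IsUnit ((p : ℕ) : ZMod l) := fun p => by
    rw [isUnit_iff_ne_zero, Ne, ZMod.natCast_eq_zero_iff]
    exact hlP p p.2
  let u : P → (ZMod l)ˣ := fun p => (hu p).unit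
  have huc : ∀ p : P, ((u p : (ZMod l)ˣ) : ZMod l) = ((p : ℕ) : ZMod l) := fun p => (hu p).unit_spec
  obtain ⟨K, hK⟩ := exists_kernel_aux q hR
    (fun p : P => (Additive.ofMul (u p : (ZMod l)ˣ ⧸ R) : Additive ((ZMod l)ˣ ⧸ R)))
  refine ⟨K, fun m => ?_⟩
  have h1 : ∑ p : P, m p • (Additive.ofMul (u p : (ZMod l)ˣ ⧸ R) : Additive ((ZMod l)ˣ ⧸ R)) =
      Additive.ofMul ((∏ p : P, u p ^ m p : (ZMod l)ˣ) : (ZMod l)ˣ ⧸ R) := by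
    rw [← QuotientGroup.mk'_apply, map_prod, ofMul_prod]
    simp
  rw [hK, h1, ofMul_eq_zero, QuotientGroup.eq_one_iff]
  have h2 : ((∏ p : P, u p ^ m p : (ZMod l)ˣ) : ZMod l) = ∏ p : P, ((p : ℕ) : ZMod l) ^ m p := by
    simp [huc]
  constructor
  · rintro ⟨g, hg⟩
    refine ⟨g, ?_⟩
    rw [← h2, ← hg]; simp
  · rintro ⟨x, hx⟩
    rcases eq_or_ne q 0 with rfl | hq0
    · refine ⟨1, ?_⟩
      apply Units.ext
      rw [h2, ← hx]; simp
    have hx0 : x ≠ 0 := by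
      rintro rfl
      rw [zero_pow hq0, ← h2] at hx
      exact Units.ne_zero _ hx.symm
    refine ⟨Units.mk0 x hx0, ?_⟩
    apply Units.ext
    rw [h2, ← hx]; simp

lemma not_pow (q : ℕ) (P : Finset ℕ) (hP : ∀ p ∈ P, p.Prime) (m : P → ℕ) (p : P)
    (hm : ¬ q ∣ m p) : ¬ ∃ r : ℤ, r ^ q = ((∏ p : P, (p : ℕ) ^ m p : ℕ) : ℤ) := by
  rintro ⟨r, hr⟩
  have h1 : r.natAbs ^ q = ∏ p : P, (p : ℕ) ^ m p := by
    rw [← Int.natAbs_pow, hr, Int.natAbs_natCast]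
  have h2 := congrArg (fun n => n.factorization p) h1
  simp only [Nat.factorization_pow, Finsupp.smul_apply, smul_eq_mul] at h2
  rw [Nat.factorization_prod (fun (i : P) _ => pow_ne_zero _ (hP i i.2).ne_zero)] at h2
  rw [Finsupp.finsetSum_apply, Finset.sum_eq_single p] at h2
  · rw [(hP p p.2).factorization_pow, Finsupp.single_eq_same] at h2
    exact hm ⟨_, h2.symm⟩
  · intro i _ hi
    rw [(hP i i.2).factorization_pow, Finsupp.single_eq_of_ne]
    intro h; exact hi (Subtype.ext h.symm)
  · simp

lemma exists_primes (q : ℕ) (hq : q.Prime) (P : Finset ℕ) (hP : ∀ p ∈ P, p.Prime) (Δ : ℕ)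
    (hΔ : 0 < Δ) (d : ℕ) : ∀ W : Submodule (ZMod q) (P → ZMod q), Module.finrank (ZMod q) W ≤ d →
      ∃ L : List ℕ, L.length ≤ d ∧ (∀ l ∈ L, l.Prime ∧ ¬ l ∣ Δ) ∧ ∀ m : P → ℕ,
        (fun p => (m p : ZMod q)) ∈ W →
        (∀ l ∈ L, ∃ x : ZMod l, x ^ q = ∏ p : P, ((p : ℕ) : ZMod l) ^ m p) → ∀ p, q ∣ m p := by
  have : Fact q.Prime := ⟨hq⟩
  have hbot : ∀ m : P → ℕ, (fun p => (m p : ZMod q)) ∈ (⊥ : Submodule (ZMod q) (P → ZMod q)) →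
      ∀ p, q ∣ m p := by
    intro m hm p
    rw [Submodule.mem_bot] at hm
    exact (ZMod.natCast_eq_zero_iff _ _).1 (congrFun hm p)
  induction d with
  | zero =>
    intro W hW
    have : W = ⊥ := Submodule.finrank_eq_zero.1 (Nat.le_zero.1 hW)
    subst this
    exact ⟨[], by simp, by simp, fun m hm _ => hbot m hm⟩
  | succ d ih =>
    intro W hW
    by_cases hW0 : W = ⊥
    · subst hW0
      exact ⟨[], by simp, by simp, fun m hm _ => hbot m hm⟩
    obtain ⟨w, hw, hw0⟩ := Submodule.exists_mem_ne_zero_of_ne_bot hW0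
    obtain ⟨p, hp⟩ := Function.ne_iff.1 hw0
    let m : P → ℕ := fun p => (w p).val
    have hmw : (fun p => (m p : ZMod q)) = w := by ext p; simp [m]
    have hmp : ¬ q ∣ m p := by
      rw [← ZMod.natCast_eq_zero_iff]; simpa [m] using hp
    have hprod : 0 < ∏ p ∈ P, p := Finset.prod_pos fun p hp => (hP p hp).pos
    obtain ⟨l, hl, hlΔ, hlx⟩ := exists_nonresidue q hq _ (not_pow q P hP m p hmp)
      (Δ * ∏ p ∈ P, p) (by positivity)
    obtain ⟨K, hK⟩ := exists_kernel q P l hl (fun p hp h =>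
      hlΔ ((h.trans (Finset.dvd_prod_of_mem _ hp)).mul_left _))
    have hlt : W ⊓ K < W := by
      apply lt_of_le_of_ne inf_le_left
      intro h
      have : w ∈ K := (inf_eq_left.1 h) hw
      rw [← hmw, hK] at this
      apply hlx
      obtain ⟨x, hx⟩ := this
      exact ⟨x, by rw [hx]; push_cast; rfl⟩
    have hfr := Submodule.finrank_lt_finrank_of_lt hlt
    obtain ⟨L, hL1, hL2, hL3⟩ := ih (W ⊓ K) (by omega)
    refine ⟨l :: L, by simpa using hL1, ?_, ?_⟩
    · intro l' hl'
      rcases List.mem_cons.1 hl' with rfl | h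
      · exact ⟨hl, fun h => hlΔ (h.mul_right _)⟩
      · exact hL2 l' h
    · intro m' hm' hx
      exact hL3 m' ⟨hm', (hK m').2 (hx l (by simp))⟩ (fun l' hl' => hx l' (by simp [hl']))

lemma decomp (q n : ℕ) (hn : n ≠ 0) (P : Finset ℕ)
    (h : ∀ p, p ∉ P → q ∣ n.factorization p) :
    ∃ t : ℕ, n = t ^ q * ∏ p ∈ P, p ^ n.factorization p := by
  refine ⟨∏ p ∈ n.primeFactors \ P, p ^ (n.factorization p / q), ?_⟩
  conv_lhs => rw [← Nat.prod_factorization_pow_eq_self hn]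
  rw [Finsupp.prod_of_support_subset _ (s := n.primeFactors ∪ P) (by simp) _ (by simp),
    ← Finset.sdiff_union_self_eq_union, Finset.prod_union Finset.sdiff_disjoint,
    ← Finset.prod_pow]
  congr 1
  apply Finset.prod_congr rfl
  intro p hp
  rw [← pow_mul, Nat.div_mul_cancel (h p (Finset.mem_sdiff.1 hp).2)]

/-- **Proposition.** If a finite set `S` of integers containing no perfect `q`-th power belongs
to `𝒯_{k,q}`, then at least `k + 1` distinct primes divide `∏_{s ∈ S} rad_q(|s|)`. -/
theorem stmt1 (q k : ℕ) (hq : q.Prime) (hodd : Odd q) (hk : 1 ≤ k)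
    (S : Finset ℤ) (hSpow : ∀ s ∈ S, ¬ IsPerfectPow q s)
    (hS : MemT q k ↑S) :
    k + 1 ≤ (qPrimes q S).card := by
  have : Fact q.Prime := ⟨hq⟩
  by_contra! hcon
  obtain ⟨Δ, hΔ, hN⟩ := hS
  have hS0 : ∀ s ∈ S, s ≠ 0 := by
    rintro s hs rfl
    exact hSpow 0 hs ⟨0, zero_pow hq.ne_zero⟩
  set P := qPrimes q S with hPdef
  have hmem : ∀ p, p ∈ P ↔ ∃ s ∈ S, p ∈ s.natAbs.primeFactors ∧ ¬ q ∣ s.natAbs.factorization p := by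
    intro p
    rw [hPdef, qPrimes, Finset.mem_sup]
    simp only [Finset.mem_filter]
  have hP : ∀ p ∈ P, p.Prime := by
    intro p hp
    obtain ⟨s, _, h, _⟩ := (hmem p).1 hp
    exact Nat.prime_of_mem_primeFactors h
  have hPr : 0 < ∏ s ∈ S, s.natAbs := Finset.prod_pos fun s hs => Int.natAbs_pos.2 (hS0 s hs)
  obtain ⟨L, hL1, hL2, hL3⟩ := exists_primes q hq P hP (Δ * ∏ s ∈ S, s.natAbs) (by positivity)
    P.card ⊤ (by rw [finrank_top]; simp)
  have hLp : ∀ l ∈ L, l.Prime := fun l hl => (hL2 l hl).1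
  have hperm := Nat.primeFactorsList_unique (n := L.prod) rfl hLp
  obtain ⟨s, hs, x, hx⟩ := hN L.prod (List.prod_pos fun l hl => (hLp l hl).pos)
    (by rw [← hperm.length_eq]; omega)
    (by
      rw [Nat.coprime_list_prod_left_iff]
      intro l hl
      exact (Nat.Prime.coprime_iff_not_dvd (hLp l hl)).2 fun h => (hL2 l hl).2 (h.mul_right _))
  have hs : s ∈ S := by simpa using hs
  have hsn : s.natAbs ≠ 0 := Int.natAbs_ne_zero.2 (hS0 s hs)
  have hdv : ∀ p, p ∉ P → q ∣ s.natAbs.factorization p := by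
    intro p hp
    by_contra h
    apply hp
    refine (hmem p).2 ⟨s, hs, ?_, h⟩
    rw [← Nat.support_factorization, Finsupp.mem_support_iff]
    intro h0; rw [h0] at h; exact h (dvd_zero _)
  have hsign : ∀ n : ℕ, ∃ e : ℤ, IsUnit e ∧ s = e ^ q * s.natAbs := by
    intro _
    rcases Int.natAbs_eq s with h | h
    · exact ⟨1, isUnit_one, by rw [one_pow, one_mul]; exact h⟩
    · exact ⟨-1, isUnit_one.neg, by rw [hodd.neg_one_pow, neg_one_mul]; exact h⟩
  obtain ⟨e, he, hse⟩ := hsign 0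
  obtain ⟨t, ht⟩ := decomp q s.natAbs hsn P hdv
  have hall := hL3 (fun p => s.natAbs.factorization p) trivial (by
    intro l hl
    have : Fact l.Prime := ⟨hLp l hl⟩
    have h1 : (l : ℤ) ∣ x ^ q - s :=
      (Int.natCast_dvd_natCast.2 (List.dvd_prod hl)).trans hx
    have h2 : ((x : ZMod l)) ^ q = (s : ZMod l) := by
      have := (ZMod.intCast_zmod_eq_zero_iff_dvd _ _).2 h1
      push_cast at this
      exact sub_eq_zero.1 this
    have hs0 : (s : ZMod l) ≠ 0 := by
      rw [Ne, ZMod.intCast_zmod_eq_zero_iff_dvd, Int.natCast_dvd]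
      intro h
      exact (hL2 l hl).2 ((h.trans (Finset.dvd_prod_of_mem _ hs)).mul_left _)
    have hB : ∏ p : P, ((p : ℕ) : ZMod l) ^ s.natAbs.factorization p =
        ((∏ p ∈ P, p ^ s.natAbs.factorization p : ℕ) : ZMod l) := by
      push_cast
      exact Finset.prod_coe_sort P (fun p => ((p : ℕ) : ZMod l) ^ s.natAbs.factorization p)
    rw [hB]
    set B := ∏ p ∈ P, p ^ s.natAbs.factorization p with hBdef
    have h3 : (s : ZMod l) = ((e : ZMod l) * t) ^ q * B := by
      rw [hse, ht]; push_cast; ring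
    have h4 : ((e : ZMod l) * t) ≠ 0 := by
      intro h
      rw [h, zero_pow hq.ne_zero, zero_mul] at h3
      exact hs0 h3
    refine ⟨x / (e * t), ?_⟩
    rw [div_pow, h2, h3]
    field_simp)
  obtain ⟨r, hr⟩ := decomp q s.natAbs hsn ∅ (by
    intro p _
    by_cases hp : p ∈ P
    · exact hall ⟨p, hp⟩
    · exact hdv p hp)
  refine hSpow s hs ⟨e * r, ?_⟩
  rw [hse, mul_pow]
  congr 1
  rw [hr]; simp
end
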